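/- arXiv:1710.08722 — 3 statements merged into one kernel-verified Lean document; each statement's English description precedes it below -/
import Mathlib

section
/- Let d ≥ 2 be an integer, σ ∈ (0,1), and ε > 0. Then there exists a radial function ζ ∈ C_c^∞(ℝ^d \ {0}), not identically zero (radial meaning ζ(x) = g(|x|) for some function g of one variable), such that (c_{d,σ}/2) ∬_{ℝ^d×ℝ^d} |ζ(x)−ζ(y)|² |x−y|^{−d−2σ} dx dy ≤ (H_{d,σ} + ε) ∫_{ℝ^d} |ζ(x)|² |x|^{−2σ} dx. -/
open MeasureTheory
open scoped ENNReal

noncomputable section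

/-- The optimal constant in the fractional Hardy–Rellich inequality:
`H_{d,σ} = 2^{2σ} Γ(d/4+σ/2)² / Γ(d/4−σ/2)²`. -/
def hardyConst (d : ℕ) (σ : ℝ) : ℝ :=
  (2 : ℝ) ^ (2 * σ) * Real.Gamma ((d : ℝ)/4 + σ/2) ^ 2 / Real.Gamma ((d : ℝ)/4 - σ/2) ^ 2

/-- The normalizing constant of the fractional Laplacian:
`c_{d,σ} = 2^{2σ} π^{−d/2} (Γ(d/2+σ)/Γ(2−σ)) σ(1−σ)`. -/
def fracLapConst (d : ℕ) (σ : ℝ) : ℝ :=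
  (2 : ℝ) ^ (2 * σ) * Real.pi ^ (-(d : ℝ)/2) *
    (Real.Gamma ((d : ℝ)/2 + σ) / Real.Gamma (2 - σ)) * (σ * (1 - σ))


lemma hs_scale1 (φ : ℝ → ℝ≥0∞) (c s : ℝ) (hs : 0 < s) :
    ∫⁻ t in Set.Ioi (0:ℝ), ENNReal.ofReal (t ^ (c - 1)) * φ (t / s) =
      ENNReal.ofReal (s ^ c) * ∫⁻ t in Set.Ioi (0:ℝ), ENNReal.ofReal (t ^ (c - 1)) * φ t := by
  have himg : (fun t : ℝ => s * t) '' Set.Ioi 0 = Set.Ioi 0 := by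
    ext u; constructor
    · rintro ⟨t, ht, rfl⟩; exact mul_pos hs ht
    · intro hu; exact ⟨u / s, div_pos hu hs, by field_simp⟩
  have key := lintegral_image_eq_lintegral_abs_deriv_mul (s := Set.Ioi (0:ℝ))
    (f := fun t : ℝ => s * t) (f' := fun _ => s) measurableSet_Ioi
    (fun x _ => by simpa using ((hasDerivAt_id x).const_mul s).hasDerivWithinAt)
    (fun a _ b _ h => mul_left_cancel₀ hs.ne' h)
    (fun t => ENNReal.ofReal (t ^ (c - 1)) * φ (t / s))
  rw [himg] at key
  rw [key, ← lintegral_const_mul' _ _ ENNReal.ofReal_ne_top]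
  refine setLIntegral_congr_fun measurableSet_Ioi (fun t ht => ?_)
  have ht' : (0:ℝ) < t := ht
  rw [← mul_assoc, ← ENNReal.ofReal_mul (abs_nonneg _), ← mul_assoc,
    ← ENNReal.ofReal_mul (by positivity), abs_of_pos hs, Real.mul_rpow hs.le ht'.le,
    mul_div_cancel_left₀ _ hs.ne', ← mul_assoc]
  congr 3
  rw [Real.rpow_sub_one hs.ne']; field_simp

lemma hs_mellin (a r : ℝ) (ha : 0 < a) (hr : 0 < r) :
    ∫⁻ t in Set.Ioi (0:ℝ), ENNReal.ofReal (t ^ (-1 - a) * Real.exp (-r / t)) =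
      ENNReal.ofReal (r ^ (-a) * Real.Gamma a) := by
  have himg : (fun t : ℝ => t⁻¹) '' Set.Ioi 0 = Set.Ioi 0 := by
    ext u; constructor
    · rintro ⟨t, ht, rfl⟩; exact inv_pos.2 (Set.mem_Ioi.1 ht)
    · intro hu; exact ⟨u⁻¹, Set.mem_Ioi.2 (inv_pos.2 (Set.mem_Ioi.1 hu)), inv_inv u⟩
  have key := lintegral_image_eq_lintegral_abs_deriv_mul (s := Set.Ioi (0:ℝ))
    (f := fun t : ℝ => t⁻¹) (f' := fun t => -(t ^ 2)⁻¹) measurableSet_Ioi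
    (fun x hx => (hasDerivAt_inv (ne_of_gt hx)).hasDerivWithinAt)
    (fun a _ b _ h => inv_injective h)
    (fun t => ENNReal.ofReal (t ^ (-1 - a) * Real.exp (-r / t)))
  rw [himg] at key
  have hG := Real.integral_rpow_mul_exp_neg_mul_Ioi ha hr
  have hintg : IntegrableOn (fun t : ℝ => t ^ (a - 1) * Real.exp (-(r * t))) (Set.Ioi 0) := by
    have := Real.GammaIntegral_convergent ha
    by_contra hcon
    have h0 := integral_undef hcon
    rw [hG] at h0
    have : 0 < (1 / r) ^ a * Real.Gamma a :=
      mul_pos (Real.rpow_pos_of_pos (by positivity) _) (Real.Gamma_pos_of_pos ha)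
    linarith
  rw [key]
  have h2 : (r ^ (-a) * Real.Gamma a) = (1 / r) ^ a * Real.Gamma a := by
    rw [one_div, Real.inv_rpow hr.le, Real.rpow_neg hr.le]
  rw [h2, ← hG, ofReal_integral_eq_lintegral_ofReal hintg]
  · refine setLIntegral_congr_fun measurableSet_Ioi (fun t ht => ?_)
    have ht' : (0:ℝ) < t := ht
    rw [← ENNReal.ofReal_mul (abs_nonneg _)]
    congr 1
    rw [abs_neg, abs_of_pos (by positivity), Real.inv_rpow ht'.le, ← Real.rpow_neg ht'.le,
      ← mul_assoc]
    congr 1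
    · rw [show -(-1 - a) = (a - 1) + 2 by ring, Real.rpow_add ht']
      norm_cast
      field_simp
    · congr 1; field_simp
  · filter_upwards [self_mem_ae_restrict measurableSet_Ioi] with t ht
    have ht' : (0:ℝ) < t := ht
    positivity

/-- `κ_p(τ) = (1-τ)_+^p`. -/
def hsK (p τ : ℝ) : ℝ := if τ < 1 then (1 - τ) ^ p else 0

lemma hsK_nonneg (p τ : ℝ) : 0 ≤ hsK p τ := by
  unfold hsK; split_ifs with h
  · exact Real.rpow_nonneg (by linarith) _
  · exact le_rfl

lemma hsK_meas (p : ℝ) : Measurable (hsK p) :=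
  Measurable.ite measurableSet_Iio (by fun_prop) (by fun_prop)

lemma hs_beta (a b : ℝ) (ha : 0 < a) (hb : 0 < b) :
    ∫⁻ t in Set.Ioo (0:ℝ) 1, ENNReal.ofReal (t ^ (a - 1) * (1 - t) ^ (b - 1)) =
      ENNReal.ofReal (ProbabilityTheory.beta a b) := by
  have hB := ProbabilityTheory.beta_pos ha hb
  have h1 := ProbabilityTheory.lintegral_betaPDF_eq_one ha hb
  rw [ProbabilityTheory.lintegral_betaPDF] at h1
  have : ∀ x : ℝ, ENNReal.ofReal (1 / ProbabilityTheory.beta a b * x ^ (a - 1) * (1 - x) ^ (b - 1))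
      = ENNReal.ofReal (1 / ProbabilityTheory.beta a b) *
        ENNReal.ofReal (x ^ (a - 1) * (1 - x) ^ (b - 1)) := by
    intro x
    rw [← ENNReal.ofReal_mul (by positivity), mul_assoc]
  simp_rw [this] at h1
  rw [lintegral_const_mul' _ _ ENNReal.ofReal_ne_top] at h1
  calc _ = ENNReal.ofReal (ProbabilityTheory.beta a b) *
      (ENNReal.ofReal (1 / ProbabilityTheory.beta a b) *
        ∫⁻ t in Set.Ioo (0:ℝ) 1, ENNReal.ofReal (t ^ (a - 1) * (1 - t) ^ (b - 1))) := by
        rw [← mul_assoc, ← ENNReal.ofReal_mul hB.le, mul_one_div_cancel hB.ne']; simp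
    _ = _ := by rw [h1, mul_one]

lemma hs_betaK (c b : ℝ) (hc : 0 < c) (hb : 0 < b) :
    ∫⁻ t in Set.Ioi (0:ℝ), ENNReal.ofReal (t ^ (c - 1)) * ENNReal.ofReal (hsK (b - 1) t) ≠ ⊤ := by
  have : ∫⁻ t in Set.Ioi (0:ℝ), ENNReal.ofReal (t ^ (c - 1)) * ENNReal.ofReal (hsK (b - 1) t)
      = ∫⁻ t in Set.Ioo (0:ℝ) 1, ENNReal.ofReal (t ^ (c - 1) * (1 - t) ^ (b - 1)) := by
    rw [← lintegral_indicator measurableSet_Ioi, ← lintegral_indicator measurableSet_Ioo]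
    congr 1; ext t
    by_cases h0 : 0 < t <;> by_cases h1 : t < 1
    · rw [Set.indicator_of_mem (show t ∈ Set.Ioi 0 from h0),
        Set.indicator_of_mem (show t ∈ Set.Ioo 0 1 from ⟨h0, h1⟩), hsK, if_pos h1,
        ENNReal.ofReal_mul (by positivity)]
    all_goals simp [Set.indicator, hsK, h0, h1]
  rw [this, hs_beta c b hc hb]
  exact ENNReal.ofReal_ne_top

lemma hs_shift (p t : ℝ) (ht : 0 < t) (F : ℝ → ℝ≥0∞) :
    ∫⁻ s in Set.Ioi (0:ℝ), ENNReal.ofReal (s ^ p) * F (s + t) =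
      ∫⁻ s in Set.Ioi (0:ℝ), ENNReal.ofReal (s ^ p) * (ENNReal.ofReal (hsK p (t / s)) * F s) := by
  rw [← lintegral_indicator measurableSet_Ioi, ← lintegral_indicator measurableSet_Ioi,
    ← lintegral_add_right_eq_self (μ := volume) (fun s => Set.indicator (Set.Ioi (0:ℝ))
      (fun s => ENNReal.ofReal (s ^ p) * (ENNReal.ofReal (hsK p (t / s)) * F s)) s) t]
  congr 1; ext s
  by_cases h0 : 0 < s
  · have h1 : 0 < s + t := by linarith
    have h2 : t / (s + t) < 1 := (div_lt_one h1).2 (by linarith)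
    rw [Set.indicator_of_mem (show s ∈ Set.Ioi 0 from h0),
      Set.indicator_of_mem (show s + t ∈ Set.Ioi 0 from h1), ← mul_assoc,
      ← ENNReal.ofReal_mul (by positivity), hsK, if_pos h2,
      ← Real.mul_rpow h1.le (by linarith)]
    congr 3; field_simp; ring
  · rw [Set.indicator_of_notMem (show s ∉ Set.Ioi 0 from h0)]
    by_cases h1 : 0 < s + t
    · have h2 : ¬ t / (s + t) < 1 := by
        rw [div_lt_one h1]; linarith
      simp [Set.indicator, hsK, h2]
    · simp [Set.indicator, h1]

lemma hs_bern (u p : ℝ) (h0 : 0 < u) (h1 : u < 1) :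
    |1 - u ^ p| ≤ (|p| + 1) * ((1 - u) * (1 + u ^ p)) := by
  have main : ∀ q : ℝ, 0 ≤ q → 1 - u ^ q ≤ (q + 1) * (1 - u) := by
    intro q hq
    have h := one_add_mul_self_le_rpow_one_add (s := u - 1) (by linarith) (p := q + 1) (by linarith)
    have h2 : u ^ (q + 1) ≤ u ^ q := Real.rpow_le_rpow_of_exponent_ge h0 h1.le (by linarith)
    rw [show 1 + (u - 1) = u by ring] at h
    linarith
  have hup : 0 < u ^ p := Real.rpow_pos_of_pos h0 p
  rcases le_or_gt 0 p with hp | hp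
  · have := main p hp
    have h2 : u ^ p ≤ 1 := Real.rpow_le_one h0.le h1.le hp
    rw [abs_of_nonneg (by linarith), abs_of_nonneg hp]
    nlinarith [mul_pos (sub_pos.2 h1) hup, mul_nonneg hp (mul_pos (sub_pos.2 h1) hup).le]
  · have h3 := main (-p) (by linarith)
    have h2 : 1 ≤ u ^ p := Real.one_le_rpow_of_pos_of_le_one_of_nonpos h0 h1.le hp.le
    rw [abs_of_nonpos (by linarith), abs_of_neg hp]
    have h4 : u ^ p * u ^ (-p) = 1 := by rw [← Real.rpow_add h0]; simp
    have h5 := mul_le_mul_of_nonneg_left h3 hup.le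
    have h6 : 0 ≤ (-p + 1) * (1 - u) := mul_nonneg (by linarith) (by linarith)
    nlinarith

lemma hs_integrable_beta (a b : ℝ) (ha : 0 < a) (hb : 0 < b) :
    IntegrableOn (fun t : ℝ => t ^ (a - 1) * (1 - t) ^ (b - 1)) (Set.Ioo 0 1) := by
  refine ⟨by fun_prop, ?_⟩
  rw [hasFiniteIntegral_iff_ofReal]
  · rw [hs_beta a b ha hb]; exact ENNReal.ofReal_lt_top
  · filter_upwards [self_mem_ae_restrict measurableSet_Ioo] with t ht
    have h1 := ht.1
    have h2 := sub_pos.2 ht.2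
    positivity

lemma hs_integral_beta (a b : ℝ) (ha : 0 < a) (hb : 0 < b) :
    ∫ t in Set.Ioo (0:ℝ) 1, t ^ (a - 1) * (1 - t) ^ (b - 1) = ProbabilityTheory.beta a b := by
  rw [integral_eq_lintegral_of_nonneg_ae, hs_beta a b ha hb,
    ENNReal.toReal_ofReal (ProbabilityTheory.beta_pos ha hb).le]
  · filter_upwards [self_mem_ae_restrict measurableSet_Ioo] with t ht
    have h1 := ht.1
    have h2 := sub_pos.2 ht.2
    simp only [Pi.zero_apply]
    positivity
  · fun_prop

lemma hs_int01 (σ b : ℝ) (h1 : σ < 1) (hb : 0 < b) :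
    IntegrableOn (fun t : ℝ => t ^ (-σ - 1) * (1 - (1 - t) ^ (b - 1))) (Set.Ioo 0 1) := by
  have i1 := hs_integrable_beta (1 - σ) 1 (by linarith) one_pos
  have i2 := hs_integrable_beta (1 - σ) b (by linarith) hb
  have i3 := (i1.add i2).const_mul (|b - 1| + 1)
  refine Integrable.mono' i3 (by fun_prop) ?_
  filter_upwards [self_mem_ae_restrict measurableSet_Ioo] with t ht
  have ht0 := ht.1
  have hb := hs_bern (1 - t) (b - 1) (by linarith [ht.2]) (by linarith [ht.1])
  have e : t ^ (1 - σ - 1) = t ^ (-σ - 1) * t := by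
    rw [← Real.rpow_add_one ht0.ne']; congr 1; ring
  rw [Real.norm_eq_abs, abs_mul, abs_of_pos (Real.rpow_pos_of_pos ht0 _)]
  simp only [Pi.add_apply]
  rw [e]
  calc _ ≤ t ^ (-σ - 1) * ((|b - 1| + 1) * ((1 - (1 - t)) * (1 + (1 - t) ^ (b - 1)))) := by
        gcongr
    _ = _ := by simp; ring

lemma hs_val01 (σ b : ℝ) (h0 : 0 < σ) (h1 : σ < 1) (hb : 0 < b) :
    ∫ t in Set.Ioo (0:ℝ) 1, t ^ (-σ - 1) * (1 - (1 - t) ^ (b - 1)) =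
      ((b - σ) * ProbabilityTheory.beta (1 - σ) b - 1) / σ := by
  have i2 := hs_integrable_beta (1 - σ) b (by linarith) hb
  have i1 := hs_int01 σ b h1 hb
  have i3 := (i2.const_mul (b - σ)).sub (i1.const_mul σ)
  have hF : ∫ t in (0:ℝ)..1, ((b - σ) * (t ^ (1 - σ - 1) * (1 - t) ^ (b - 1)) -
      σ * (t ^ (-σ - 1) * (1 - (1 - t) ^ (b - 1)))) = 1 - 0 := by
    refine intervalIntegral.integral_eq_sub_of_hasDerivAt_of_tendsto
      (f := fun t => t ^ (-σ) * (1 - (1 - t) ^ b)) one_pos ?_ ?_ ?_ ?_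
    · intro t ht
      have ht0 := ht.1
      have ht1 : 0 < 1 - t := sub_pos.2 ht.2
      have d1 := Real.hasDerivAt_rpow_const (x := t) (p := -σ) (Or.inl ht0.ne')
      have d2 := ((hasDerivAt_id t).const_sub 1).rpow_const (p := b) (Or.inl ht1.ne')
      have d3 := d1.mul (d2.const_sub 1)
      convert! d3 using 1
      have e1 : t ^ (1 - σ - 1) = t ^ (-σ - 1) * t := by
        rw [← Real.rpow_add_one ht0.ne']; congr 1; ring
      have e2 : t ^ (-σ) = t ^ (-σ - 1) * t := by
        rw [← Real.rpow_add_one ht0.ne']; congr 1; ring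
      have e3 : (1 - t) ^ b = (1 - t) ^ (b - 1) * (1 - t) := by
        rw [← Real.rpow_add_one ht1.ne']; congr 1; ring
      simp only [id]
      rw [e1, e2, e3]; ring
    · rw [intervalIntegrable_iff_integrableOn_Ioo_of_le zero_le_one]
      exact i3
    · have lim : Filter.Tendsto (fun t : ℝ => (|b| + 1) * (t ^ (1 - σ) * 2))
          (nhdsWithin 0 (Set.Ioi 0)) (nhds 0) := by
        have : ContinuousAt (fun t : ℝ => (|b| + 1) * (t ^ (1 - σ) * 2)) 0 := by
          refine ContinuousAt.mul continuousAt_const (ContinuousAt.mul ?_ continuousAt_const)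
          exact Real.continuousAt_rpow_const _ _ (Or.inr (by linarith))
        have h := this.tendsto
        simp only [Real.zero_rpow (show 1 - σ ≠ 0 by linarith), zero_mul, mul_zero] at h
        exact h.mono_left nhdsWithin_le_nhds
      refine squeeze_zero_norm' ?_ lim
      filter_upwards [Ioo_mem_nhdsGT (show (0:ℝ) < 1 by norm_num)] with t ht
      have ht0 := ht.1
      have hbb := hs_bern (1 - t) b (by linarith [ht.2]) (by linarith [ht.1])
      have hle : (1 - t) ^ b ≤ 1 := Real.rpow_le_one (by linarith [ht.2]) (by linarith) hb.le
      have e : t ^ (1 - σ) = t ^ (-σ) * t := by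
        rw [← Real.rpow_add_one ht0.ne']; congr 1; ring
      rw [Real.norm_eq_abs, abs_mul, abs_of_pos (Real.rpow_pos_of_pos ht0 _), e]
      calc _ ≤ t ^ (-σ) * ((|b| + 1) * ((1 - (1 - t)) * (1 + (1 - t) ^ b))) := by gcongr
        _ ≤ t ^ (-σ) * ((|b| + 1) * ((1 - (1 - t)) * (1 + 1))) := by
            have : 0 ≤ 1 - (1 - t) := by linarith
            gcongr
        _ = _ := by ring
    · have : ContinuousAt (fun t : ℝ => t ^ (-σ) * (1 - (1 - t) ^ b)) 1 := by
        refine ContinuousAt.mul (Real.continuousAt_rpow_const _ _ (Or.inl one_ne_zero)) ?_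
        refine ContinuousAt.sub continuousAt_const ?_
        exact ContinuousAt.rpow_const (by fun_prop) (Or.inr hb.le)
      have h := this.tendsto
      simp only [Real.one_rpow, sub_self, Real.zero_rpow hb.ne', sub_zero, mul_one] at h
      exact h.mono_left nhdsWithin_le_nhds
  rw [intervalIntegral.integral_of_le zero_le_one, integral_Ioc_eq_integral_Ioo,
    integral_sub (i2.const_mul _) (i1.const_mul _), integral_const_mul, integral_const_mul,
    hs_integral_beta _ _ (by linarith) hb] at hF
  field_simp
  linarith

lemma hs_const (σ b : ℝ) (h0 : 0 < σ) (h1 : σ < 1) (hb : σ < b) :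
    (∫⁻ t in Set.Ioi (0:ℝ), ENNReal.ofReal (t ^ (-σ - 1)) * ENNReal.ofReal (hsK (b - 1) t - 1)) ≠ ⊤
    ∧ (∫⁻ t in Set.Ioi (0:ℝ), ENNReal.ofReal (t ^ (-σ - 1)) * ENNReal.ofReal (1 - hsK (b - 1) t))
     = (∫⁻ t in Set.Ioi (0:ℝ), ENNReal.ofReal (t ^ (-σ - 1)) * ENNReal.ofReal (hsK (b - 1) t - 1))
     + ENNReal.ofReal (Real.Gamma (1 - σ) * Real.Gamma b / (σ * Real.Gamma (b - σ))) := by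
  have hb0 : 0 < b := h0.trans hb
  set f : ℝ → ℝ := fun t => t ^ (-σ - 1) * (1 - hsK (b - 1) t) with hf
  have hfm : Measurable f := by
    have := hsK_meas (b - 1)
    fun_prop
  have iA : IntegrableOn f (Set.Ioo 0 1) := by
    refine (hs_int01 σ b h1 hb0).congr_fun (fun t ht => ?_) measurableSet_Ioo
    simp only [hf, hsK, if_pos ht.2]
  have iA' : IntegrableOn f (Set.Ioc 0 1) := by rwa [integrableOn_Ioc_iff_integrableOn_Ioo]
  have eB : ∀ t ∈ Set.Ioi (1:ℝ), t ^ (-σ - 1) = f t := by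
    intro t ht
    simp only [hf, hsK, if_neg (not_lt.2 (le_of_lt (Set.mem_Ioi.1 ht))), sub_zero, mul_one]
  have iB : IntegrableOn f (Set.Ioi 1) :=
    (integrableOn_Ioi_rpow_of_lt (a := -σ - 1) (by linarith) one_pos).congr_fun eB measurableSet_Ioi
  have hu : Set.Ioc (0:ℝ) 1 ∪ Set.Ioi 1 = Set.Ioi 0 := Set.Ioc_union_Ioi_eq_Ioi zero_le_one
  have iC : IntegrableOn f (Set.Ioi 0) := by rw [← hu]; exact iA'.union iB
  have val : ∫ t in Set.Ioi (0:ℝ), f t = Real.Gamma (1 - σ) * Real.Gamma b / (σ * Real.Gamma (b - σ)) := by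
    rw [← hu, setIntegral_union (Set.Ioc_disjoint_Ioi le_rfl)
      measurableSet_Ioi iA' iB, integral_Ioc_eq_integral_Ioo,
      ← setIntegral_congr_fun measurableSet_Ioi eB, integral_Ioi_rpow_of_lt (by linarith) one_pos,
      setIntegral_congr_fun (g := fun t : ℝ => t ^ (-σ - 1) * (1 - (1 - t) ^ (b - 1)))
        measurableSet_Ioo (fun t ht => by simp only [hf, hsK, if_pos ht.2]),
      hs_val01 σ b h0 h1 hb0, ProbabilityTheory.beta]
    have hg : Real.Gamma (1 - σ + b) = (b - σ) * Real.Gamma (b - σ) := by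
      rw [← Real.Gamma_add_one (by linarith)]; congr 1; ring
    have hg0 := (Real.Gamma_pos_of_pos (sub_pos.2 hb)).ne'
    have hbs : b - σ ≠ 0 := (sub_pos.2 hb).ne'
    rw [hg, Real.one_rpow]
    have : -σ - 1 + 1 = -σ := by ring
    rw [this]
    field_simp
    ring
  have key := integral_eq_lintegral_pos_part_sub_lintegral_neg_part iC
  have eP : ∫⁻ t in Set.Ioi (0:ℝ), ENNReal.ofReal (t ^ (-σ - 1)) * ENNReal.ofReal (1 - hsK (b - 1) t)
      = ∫⁻ t in Set.Ioi (0:ℝ), ENNReal.ofReal (f t) :=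
    setLIntegral_congr_fun measurableSet_Ioi (fun t ht => by
      have := Set.mem_Ioi.1 ht
      simp only [hf]; rw [ENNReal.ofReal_mul (by positivity)])
  have eN : ∫⁻ t in Set.Ioi (0:ℝ), ENNReal.ofReal (t ^ (-σ - 1)) * ENNReal.ofReal (hsK (b - 1) t - 1)
      = ∫⁻ t in Set.Ioi (0:ℝ), ENNReal.ofReal (-f t) :=
    setLIntegral_congr_fun measurableSet_Ioi (fun t ht => by
      have := Set.mem_Ioi.1 ht
      simp only [hf]; rw [← mul_neg, neg_sub, ENNReal.ofReal_mul (by positivity)])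
  have fP := iC.lintegral_lt_top
  have fN := iC.neg.lintegral_lt_top
  simp only [Pi.neg_apply] at fN
  rw [eP, eN]
  refine ⟨fN.ne, ?_⟩
  rw [val] at key
  rw [key, ← ENNReal.ofReal_toReal fP.ne, ← ENNReal.ofReal_toReal fN.ne,
    ENNReal.toReal_ofReal ENNReal.toReal_nonneg, ENNReal.toReal_ofReal ENNReal.toReal_nonneg,
    ← ENNReal.ofReal_add ENNReal.toReal_nonneg]
  · congr 1; ring
  · rw [← key]
    have := (Real.Gamma_pos_of_pos (sub_pos.2 hb))
    have := (Real.Gamma_pos_of_pos (sub_pos.2 h1))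
    have := (Real.Gamma_pos_of_pos hb0)
    positivity

/-- Unnormalised heat kernel. -/
def hsG {d : ℕ} (t : ℝ) (x : EuclideanSpace ℝ (Fin d)) : ℝ≥0∞ :=
  ENNReal.ofReal (t ^ (-(d:ℝ)/2) * Real.exp (-(‖x‖ ^ 2 / 4) / t))

lemma hsG_meas (d : ℕ) :
    Measurable (fun q : ℝ × EuclideanSpace ℝ (Fin d) => hsG q.1 q.2) := by
  unfold hsG; fun_prop

lemma hsG_meas' {d : ℕ} {X : Type*} [MeasurableSpace X] {f : X → ℝ}
    {g : X → EuclideanSpace ℝ (Fin d)} (hf : Measurable f) (hg : Measurable g) :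
    Measurable (fun q => hsG (f q) (g q)) := (hsG_meas d).comp (hf.prodMk hg)

lemma hsG_symm {d : ℕ} (t : ℝ) (x y : EuclideanSpace ℝ (Fin d)) :
    hsG t (x - y) = hsG t (y - x) := by
  unfold hsG; rw [norm_sub_rev]

lemma hs_gauss (d : ℕ) (c : ℝ) (hc : 0 < c) (z : EuclideanSpace ℝ (Fin d)) :
    ∫⁻ y : EuclideanSpace ℝ (Fin d), ENNReal.ofReal (Real.exp (-c * ‖y - z‖ ^ 2)) =
      ENNReal.ofReal ((Real.pi / c) ^ ((d:ℝ)/2)) := by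
  rw [lintegral_sub_right_eq_self (μ := volume) (fun y => ENNReal.ofReal (Real.exp (-c * ‖y‖ ^ 2)))]
  have h := GaussianFourier.integral_rexp_neg_mul_sq_norm (V := EuclideanSpace ℝ (Fin d)) hc
  have hpos : 0 < (Real.pi / c) ^ ((d:ℝ)/2) := Real.rpow_pos_of_pos (div_pos Real.pi_pos hc) _
  rw [finrank_euclideanSpace_fin] at h
  have hintg : Integrable (fun v : EuclideanSpace ℝ (Fin d) => Real.exp (-c * ‖v‖ ^ 2)) := by
    by_contra hcon
    rw [integral_undef hcon] at h
    linarith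
  rw [← h, ofReal_integral_eq_lintegral_ofReal hintg]
  exact Filter.Eventually.of_forall (fun _ => (Real.exp_pos _).le)

lemma hsG_mass {d : ℕ} (t : ℝ) (ht : 0 < t) (x : EuclideanSpace ℝ (Fin d)) :
    ∫⁻ y, hsG t (x - y) = ENNReal.ofReal ((4 * Real.pi) ^ ((d:ℝ)/2)) := by
  have h := hs_gauss d (1 / (4 * t)) (by positivity) x
  have : ∀ y, hsG t (x - y) = ENNReal.ofReal (t ^ (-(d:ℝ)/2)) *
      ENNReal.ofReal (Real.exp (-(1 / (4 * t)) * ‖y - x‖ ^ 2)) := by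
    intro y
    rw [hsG, ENNReal.ofReal_mul (by positivity), norm_sub_rev]
    congr 3; field_simp
  simp_rw [this]
  rw [lintegral_const_mul' _ _ ENNReal.ofReal_ne_top, h, ← ENNReal.ofReal_mul (by positivity)]
  congr 1
  rw [show Real.pi / (1 / (4 * t)) = (4 * Real.pi) * t by field_simp,
    Real.mul_rpow (by positivity) ht.le, mul_left_comm, ← Real.rpow_add ht]
  rw [show -(d:ℝ)/2 + d/2 = 0 by ring]; simp

lemma hsG_conv {d : ℕ} (t s : ℝ) (ht : 0 < t) (hs : 0 < s) (x : EuclideanSpace ℝ (Fin d)) :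
    ∫⁻ y, hsG t (x - y) * hsG s y =
      ENNReal.ofReal ((4 * Real.pi) ^ ((d:ℝ)/2)) * hsG (s + t) x := by
  have hc : 0 < (s + t) / (4 * s * t) := by positivity
  have h := hs_gauss d ((s + t) / (4 * s * t)) hc ((s / (s + t)) • x)
  have : ∀ y, hsG t (x - y) * hsG s y =
      ENNReal.ofReal (t ^ (-(d:ℝ)/2) * s ^ (-(d:ℝ)/2) * Real.exp (-(‖x‖ ^ 2 / 4) / (s + t))) *
      ENNReal.ofReal (Real.exp (-((s + t) / (4 * s * t)) * ‖y - (s / (s + t)) • x‖ ^ 2)) := by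
    intro y
    rw [hsG, hsG, ← ENNReal.ofReal_mul (by positivity), ← ENNReal.ofReal_mul (by positivity)]
    congr 1
    have e : Real.exp (-(‖x - y‖ ^ 2 / 4) / t) * Real.exp (-(‖y‖ ^ 2 / 4) / s) =
        Real.exp (-(‖x‖ ^ 2 / 4) / (s + t)) *
        Real.exp (-((s + t) / (4 * s * t)) * ‖y - (s / (s + t)) • x‖ ^ 2) := by
      rw [← Real.exp_add, ← Real.exp_add]
      congr 1
      rw [norm_sub_sq_real, norm_sub_sq_real, norm_smul, inner_smul_right, mul_pow,
        Real.norm_eq_abs, sq_abs, real_inner_comm x y]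
      have : s + t ≠ 0 := by positivity
      field_simp
      ring
    linear_combination (t ^ (-(d:ℝ)/2) * s ^ (-(d:ℝ)/2)) * e
  simp_rw [this]
  rw [lintegral_const_mul' _ _ ENNReal.ofReal_ne_top, h, hsG, ← ENNReal.ofReal_mul (by positivity),
    ← ENNReal.ofReal_mul (by positivity)]
  congr 1
  have e2 : (Real.pi / ((s + t) / (4 * s * t))) ^ ((d:ℝ)/2) =
      (4 * Real.pi) ^ ((d:ℝ)/2) * t ^ ((d:ℝ)/2) * s ^ ((d:ℝ)/2) * (s + t) ^ (-(d:ℝ)/2) := by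
    rw [show -(d:ℝ)/2 = -((d:ℝ)/2) by ring, Real.rpow_neg (by positivity),
      ← Real.mul_rpow (by positivity) (by positivity), ← Real.mul_rpow (by positivity) (by positivity),
      ← Real.inv_rpow (by positivity), ← Real.mul_rpow (by positivity) (by positivity)]
    congr 1; field_simp
  rw [e2]
  have e3 : ∀ r : ℝ, 0 < r → r ^ (-(d:ℝ)/2) * r ^ ((d:ℝ)/2) = 1 := by
    intro r hr; rw [← Real.rpow_add hr, show -(d:ℝ)/2 + d/2 = 0 by ring, Real.rpow_zero]
  linear_combination ((4 * Real.pi) ^ ((d:ℝ)/2) * (s + t) ^ (-(d:ℝ)/2) *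
    Real.exp (-(‖x‖ ^ 2 / 4) / (s + t))) *
    (t ^ (-(d:ℝ)/2) * t ^ ((d:ℝ)/2) * e3 s hs + e3 t ht)

/-- Riesz potential. -/
def hsR {d : ℕ} (q : ℝ) (x : EuclideanSpace ℝ (Fin d)) : ℝ≥0∞ :=
  ∫⁻ t in Set.Ioi (0:ℝ), ENNReal.ofReal (t ^ (q - 1)) * hsG t x

lemma hsR_meas (d : ℕ) (q : ℝ) : Measurable (hsR (d := d) q) := by
  unfold hsR
  refine Measurable.lintegral_prod_right' (f := fun z : EuclideanSpace ℝ (Fin d) × ℝ =>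
    ENNReal.ofReal (z.2 ^ (q - 1)) * hsG z.2 z.1) ?_
  have := hsG_meas' (d := d) (X := EuclideanSpace ℝ (Fin d) × ℝ) measurable_snd measurable_fst
  fun_prop

lemma hsR_eq {d : ℕ} (q : ℝ) (hq : q < (d:ℝ)/2) (x : EuclideanSpace ℝ (Fin d)) (hx : x ≠ 0) :
    hsR q x = ENNReal.ofReal ((4 ^ ((d:ℝ)/2 - q) * Real.Gamma ((d:ℝ)/2 - q)) *
      ‖x‖ ^ (2 * q - d)) := by
  have hx' : 0 < ‖x‖ := norm_pos_iff.2 hx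
  have h := hs_mellin ((d:ℝ)/2 - q) (‖x‖ ^ 2 / 4) (by linarith) (by positivity)
  rw [hsR]
  have e : ∫⁻ t in Set.Ioi (0:ℝ), ENNReal.ofReal (t ^ (q - 1)) * hsG t x =
      ∫⁻ t in Set.Ioi (0:ℝ), ENNReal.ofReal (t ^ (-1 - ((d:ℝ)/2 - q)) *
        Real.exp (-(‖x‖ ^ 2 / 4) / t)) := by
    refine setLIntegral_congr_fun measurableSet_Ioi (fun t ht => ?_)
    have ht' : (0:ℝ) < t := ht
    rw [hsG, ← ENNReal.ofReal_mul (by positivity), ← mul_assoc, ← Real.rpow_add ht']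
    congr 3; ring_nf
  rw [e, h]
  congr 1
  rw [Real.div_rpow (by positivity) (by norm_num), Real.rpow_neg (by norm_num : (0:ℝ) ≤ 4),
    ← Real.rpow_natCast, ← Real.rpow_mul hx'.le]
  rw [show ((2:ℕ):ℝ) * -((d:ℝ)/2 - q) = 2 * q - d by push_cast; ring]
  field_simp

/-- The heat semigroup acting on a Riesz potential. -/
lemma hsR_heat {d : ℕ} (q t : ℝ) (ht : 0 < t) (x : EuclideanSpace ℝ (Fin d)) :
    ∫⁻ y, hsG t (x - y) * hsR q y = ENNReal.ofReal ((4 * Real.pi) ^ ((d:ℝ)/2)) *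
      ∫⁻ s in Set.Ioi (0:ℝ), ENNReal.ofReal (s ^ (q - 1)) *
        (ENNReal.ofReal (hsK (q - 1) (t / s)) * hsG s x) := by
  rw [← hs_shift (q - 1) t ht (fun s => hsG s x), ← lintegral_const_mul' _ _ ENNReal.ofReal_ne_top]
  have m1 := hsG_meas' (d := d) (X := EuclideanSpace ℝ (Fin d) × ℝ) measurable_snd measurable_fst
  have m2 : Measurable (fun z : EuclideanSpace ℝ (Fin d) × ℝ => hsG t (x - z.1)) :=
    hsG_meas' (d := d) measurable_const (by fun_prop)
  have m3 : Measurable (fun y : EuclideanSpace ℝ (Fin d) => hsG t (x - y)) :=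
    hsG_meas' (d := d) measurable_const (by fun_prop)
  calc _ = ∫⁻ y, ∫⁻ s in Set.Ioi (0:ℝ), hsG t (x - y) *
        (ENNReal.ofReal (s ^ (q - 1)) * hsG s y) := by
        congr 1; ext y
        rw [hsR, lintegral_const_mul' _ _ (by unfold hsG; exact ENNReal.ofReal_ne_top)]
    _ = ∫⁻ s in Set.Ioi (0:ℝ), ∫⁻ y, hsG t (x - y) *
        (ENNReal.ofReal (s ^ (q - 1)) * hsG s y) := by
        refine lintegral_lintegral_swap (Measurable.aemeasurable ?_)
        simp only [Function.uncurry_def]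
        fun_prop
    _ = _ := by
        refine setLIntegral_congr_fun measurableSet_Ioi (fun s hs => ?_)
        rw [mul_left_comm, ← hsG_conv t s ht hs x, ← lintegral_const_mul' _ _ ENNReal.ofReal_ne_top]
        congr 1; ext y; ring

lemma hs_mellin_hom {d : ℕ} (c q : ℝ) (φ : ℝ → ℝ≥0∞) (hφ : Measurable φ)
    (x : EuclideanSpace ℝ (Fin d)) :
    ∫⁻ t in Set.Ioi (0:ℝ), ENNReal.ofReal (t ^ (c - 1)) *
      ∫⁻ s in Set.Ioi (0:ℝ), ENNReal.ofReal (s ^ (q - 1)) * (φ (t / s) * hsG s x) =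
    (∫⁻ t in Set.Ioi (0:ℝ), ENNReal.ofReal (t ^ (c - 1)) * φ t) * hsR (q + c) x := by
  have m1 := hsG_meas' (d := d) (X := ℝ × ℝ) (f := Prod.snd) (g := fun _ => x) measurable_snd
    measurable_const
  have m0 := hsG_meas' (d := d) (X := ℝ) (f := id) (g := fun _ => x) measurable_id
    measurable_const
  simp only [id] at m0
  calc _ = ∫⁻ t in Set.Ioi (0:ℝ), ∫⁻ s in Set.Ioi (0:ℝ), ENNReal.ofReal (t ^ (c - 1)) *
        (ENNReal.ofReal (s ^ (q - 1)) * (φ (t / s) * hsG s x)) := by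
        congr 1; ext t
        rw [lintegral_const_mul' _ _ ENNReal.ofReal_ne_top]
    _ = ∫⁻ s in Set.Ioi (0:ℝ), ∫⁻ t in Set.Ioi (0:ℝ), ENNReal.ofReal (t ^ (c - 1)) *
        (ENNReal.ofReal (s ^ (q - 1)) * (φ (t / s) * hsG s x)) := by
        refine lintegral_lintegral_swap (Measurable.aemeasurable ?_)
        simp only [Function.uncurry_def]
        fun_prop
    _ = ∫⁻ s in Set.Ioi (0:ℝ), (∫⁻ t in Set.Ioi (0:ℝ), ENNReal.ofReal (t ^ (c - 1)) * φ t) *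
          (ENNReal.ofReal (s ^ (q + c - 1)) * hsG s x) := by
        refine setLIntegral_congr_fun measurableSet_Ioi (fun s hs => ?_)
        have hs' : (0:ℝ) < s := hs
        have : ∀ t, ENNReal.ofReal (t ^ (c - 1)) *
            (ENNReal.ofReal (s ^ (q - 1)) * (φ (t / s) * hsG s x)) =
            (ENNReal.ofReal (s ^ (q - 1)) * hsG s x) * (ENNReal.ofReal (t ^ (c - 1)) * φ (t / s)) := by
          intro t; ring
        simp_rw [this]
        rw [lintegral_const_mul' _ _ (ENNReal.mul_ne_top ENNReal.ofReal_ne_top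
          (by unfold hsG; exact ENNReal.ofReal_ne_top)), hs_scale1 φ c s hs',
          show q + c - 1 = (q - 1) + c by ring, Real.rpow_add hs',
          ENNReal.ofReal_mul (by positivity)]
        ring
    _ = _ := by
        rw [lintegral_const_mul _ (by fun_prop), hsR]

lemma hs_riesz {d : ℕ} (c b : ℝ) (x : EuclideanSpace ℝ (Fin d)) :
    ∫⁻ y, hsR c (x - y) * hsR b y = ENNReal.ofReal ((4 * Real.pi) ^ ((d:ℝ)/2)) *
      ((∫⁻ t in Set.Ioi (0:ℝ), ENNReal.ofReal (t ^ (c - 1)) * ENNReal.ofReal (hsK (b - 1) t)) *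
        hsR (b + c) x) := by
  have m2 : Measurable (fun z : EuclideanSpace ℝ (Fin d) × ℝ => hsG z.2 (x - z.1)) :=
    hsG_meas' (d := d) (by fun_prop) (by fun_prop)
  have m3 := hsR_meas d b
  calc _ = ∫⁻ y, ∫⁻ t in Set.Ioi (0:ℝ), ENNReal.ofReal (t ^ (c - 1)) * hsG t (x - y) * hsR b y := by
        congr 1; ext y
        rw [hsR, lintegral_mul_const]
        have := hsG_meas' (d := d) (X := ℝ) (f := id) (g := fun _ => x - y) measurable_id
          measurable_const
        simp only [id] at this
        fun_prop
    _ = ∫⁻ t in Set.Ioi (0:ℝ), ∫⁻ y, ENNReal.ofReal (t ^ (c - 1)) * hsG t (x - y) * hsR b y := by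
        refine lintegral_lintegral_swap (Measurable.aemeasurable ?_)
        simp only [Function.uncurry_def]
        fun_prop
    _ = ∫⁻ t in Set.Ioi (0:ℝ), ENNReal.ofReal ((4 * Real.pi) ^ ((d:ℝ)/2)) *
          (ENNReal.ofReal (t ^ (c - 1)) *
          ∫⁻ s in Set.Ioi (0:ℝ), ENNReal.ofReal (s ^ (b - 1)) *
            (ENNReal.ofReal (hsK (b - 1) (t / s)) * hsG s x)) := by
        refine setLIntegral_congr_fun measurableSet_Ioi (fun t ht => ?_)
        simp_rw [mul_assoc]
        rw [lintegral_const_mul' _ _ ENNReal.ofReal_ne_top, hsR_heat b t ht x]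
        ring
    _ = _ := by
        rw [lintegral_const_mul' _ _ ENNReal.ofReal_ne_top,
          hs_mellin_hom c b (fun τ => ENNReal.ofReal (hsK (b - 1) τ))
            (ENNReal.measurable_ofReal.comp (hsK_meas _)) x]

lemma hs_dbl {d : ℕ} (c : ℝ) (F : EuclideanSpace ℝ (Fin d) × EuclideanSpace ℝ (Fin d) → ℝ≥0∞)
    (hF : Measurable F) :
    ∫⁻ t in Set.Ioi (0:ℝ), ENNReal.ofReal (t ^ (c - 1)) *
      ∫⁻ x, ∫⁻ y, F (x, y) * hsG t (x - y) = ∫⁻ x, ∫⁻ y, F (x, y) * hsR c (x - y) := by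
  have m2 : Measurable (fun z : ((EuclideanSpace ℝ (Fin d)) × EuclideanSpace ℝ (Fin d)) × ℝ =>
      hsG z.2 (z.1.1 - z.1.2)) :=
    hsG_meas' (d := d) (by fun_prop) (by fun_prop)
  have mR : Measurable (fun z : ((EuclideanSpace ℝ (Fin d)) × EuclideanSpace ℝ (Fin d)) =>
      hsR c (z.1 - z.2)) := (hsR_meas d c).comp (by fun_prop)
  rw [← lintegral_prod (fun z : (EuclideanSpace ℝ (Fin d)) × EuclideanSpace ℝ (Fin d) =>
    F z * hsR c (z.1 - z.2)) (by fun_prop)]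
  calc _ = ∫⁻ t in Set.Ioi (0:ℝ), ∫⁻ z : (EuclideanSpace ℝ (Fin d)) × EuclideanSpace ℝ (Fin d),
        ENNReal.ofReal (t ^ (c - 1)) * (F z * hsG t (z.1 - z.2)) := by
        congr 1; ext t
        have m3 : Measurable (fun z : (EuclideanSpace ℝ (Fin d)) × EuclideanSpace ℝ (Fin d) =>
          hsG t (z.1 - z.2)) := hsG_meas' (d := d) (by fun_prop) (by fun_prop)
        rw [lintegral_const_mul' _ _ ENNReal.ofReal_ne_top]
        congr 1
        exact (lintegral_prod (fun z : (EuclideanSpace ℝ (Fin d)) × EuclideanSpace ℝ (Fin d) =>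
          F z * hsG t (z.1 - z.2)) (by fun_prop)).symm
    _ = ∫⁻ z : (EuclideanSpace ℝ (Fin d)) × EuclideanSpace ℝ (Fin d), ∫⁻ t in Set.Ioi (0:ℝ),
        ENNReal.ofReal (t ^ (c - 1)) * (F z * hsG t (z.1 - z.2)) := by
        refine (lintegral_lintegral_swap (Measurable.aemeasurable ?_)).symm
        simp only [Function.uncurry_def]
        fun_prop
    _ = _ := by
        congr 1; ext z
        have := hsG_meas' (d := d) (X := ℝ) (f := id) (g := fun _ => z.1 - z.2) measurable_id
          measurable_const
        simp only [id] at this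
        rw [hsR, ← lintegral_const_mul _ (by fun_prop)]
        congr 1; ext t; ring

section ground
variable {d : ℕ}

/-- auxiliary functional -/
def hsPhi (A : EuclideanSpace ℝ (Fin d) → ℝ≥0∞) (q : ℝ) (f : ℝ → ℝ≥0∞) (t : ℝ) : ℝ≥0∞ :=
  ∫⁻ x, A x * ∫⁻ s in Set.Ioi (0:ℝ), ENNReal.ofReal (s ^ (q - 1)) * (f (t / s) * hsG s x)

lemma hsPhi_inner_meas (q : ℝ) (f : ℝ → ℝ≥0∞) (hf : Measurable f) :
    Measurable (fun z : EuclideanSpace ℝ (Fin d) × ℝ =>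
      ∫⁻ s in Set.Ioi (0:ℝ), ENNReal.ofReal (s ^ (q - 1)) * (f (z.2 / s) * hsG s z.1)) := by
  refine Measurable.lintegral_prod_right' (f := fun p : (EuclideanSpace ℝ (Fin d) × ℝ) × ℝ =>
    ENNReal.ofReal (p.2 ^ (q - 1)) * (f (p.1.2 / p.2) * hsG p.2 p.1.1)) ?_
  have m2 : Measurable (fun p : (EuclideanSpace ℝ (Fin d) × ℝ) × ℝ => hsG p.2 p.1.1) :=
    hsG_meas' (d := d) (by fun_prop) (by fun_prop)
  fun_prop

lemma hsPhi_add (A : EuclideanSpace ℝ (Fin d) → ℝ≥0∞) (hA : Measurable A) (q : ℝ)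
    (f g : ℝ → ℝ≥0∞) (hf : Measurable f) (t : ℝ) :
    hsPhi A q (fun τ => f τ + g τ) t = hsPhi A q f t + hsPhi A q g t := by
  unfold hsPhi
  have m : Measurable (fun x : EuclideanSpace ℝ (Fin d) =>
      ∫⁻ s in Set.Ioi (0:ℝ), ENNReal.ofReal (s ^ (q - 1)) * (f (t / s) * hsG s x)) :=
    (hsPhi_inner_meas q f hf).comp (measurable_id.prodMk measurable_const)
  rw [← lintegral_add_left (by fun_prop)]
  congr 1; ext x
  rw [← mul_add, ← lintegral_add_left]
  · congr 2; ext s; ring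
  · have := hsG_meas' (d := d) (X := ℝ) (f := id) (g := fun _ => x) measurable_id measurable_const
    simp only [id] at this
    fun_prop

lemma hsPhi_mellin (A : EuclideanSpace ℝ (Fin d) → ℝ≥0∞) (hA : Measurable A) (q c : ℝ)
    (f : ℝ → ℝ≥0∞) (hf : Measurable f) :
    ∫⁻ t in Set.Ioi (0:ℝ), ENNReal.ofReal (t ^ (c - 1)) * hsPhi A q f t =
      (∫⁻ t in Set.Ioi (0:ℝ), ENNReal.ofReal (t ^ (c - 1)) * f t) *
        ∫⁻ x, A x * hsR (q + c) x := by
  have m := hsPhi_inner_meas (d := d) q f hf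
  have mR := hsR_meas d (q + c)
  rw [← lintegral_const_mul _ (by fun_prop)]
  calc _ = ∫⁻ t in Set.Ioi (0:ℝ), ∫⁻ x, A x * (ENNReal.ofReal (t ^ (c - 1)) *
        ∫⁻ s in Set.Ioi (0:ℝ), ENNReal.ofReal (s ^ (q - 1)) * (f (t / s) * hsG s x)) := by
        congr 1; ext t
        rw [hsPhi, ← lintegral_const_mul' _ _ ENNReal.ofReal_ne_top]
        congr 1; ext x; ring
    _ = ∫⁻ x, ∫⁻ t in Set.Ioi (0:ℝ), A x * (ENNReal.ofReal (t ^ (c - 1)) *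
        ∫⁻ s in Set.Ioi (0:ℝ), ENNReal.ofReal (s ^ (q - 1)) * (f (t / s) * hsG s x)) := by
        refine (lintegral_lintegral_swap (Measurable.aemeasurable ?_)).symm
        simp only [Function.uncurry_def]
        fun_prop
    _ = _ := by
        congr 1; ext x
        have mx : Measurable (fun t : ℝ =>
            ∫⁻ s in Set.Ioi (0:ℝ), ENNReal.ofReal (s ^ (q - 1)) * (f (t / s) * hsG s x)) :=
          m.comp (measurable_const.prodMk measurable_id)
        rw [lintegral_const_mul _ (by fun_prop), hs_mellin_hom c q f hf x]
        ring
end ground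

lemma hs_ground_t {d : ℕ} (hd : 2 ≤ d) (b : ℝ) (v w : EuclideanSpace ℝ (Fin d) → ℝ)
    (hv : Measurable v) (hw : Measurable w) (hw0 : ∀ x, 0 ≤ w x)
    (hwR : ∀ x, x ≠ 0 → ENNReal.ofReal (w x) = hsR b x)
    (hfin : ∫⁻ x, ENNReal.ofReal (v x ^ 2 * w x) * ENNReal.ofReal (w x) ≠ ⊤) (t : ℝ) (ht : 0 < t) :
    (∫⁻ x, ∫⁻ y, ENNReal.ofReal ((v x * w x - v y * w y) ^ 2) * hsG t (x - y)) +
      2 * (ENNReal.ofReal ((4 * Real.pi) ^ ((d:ℝ)/2)) * hsPhi (fun x => ENNReal.ofReal (v x ^ 2 * w x)) b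
        (fun τ => ENNReal.ofReal (hsK (b - 1) τ - 1)) t) =
      2 * (ENNReal.ofReal ((4 * Real.pi) ^ ((d:ℝ)/2)) * hsPhi (fun x => ENNReal.ofReal (v x ^ 2 * w x)) b
        (fun τ => ENNReal.ofReal (1 - hsK (b - 1) τ)) t) +
      ∫⁻ x, ∫⁻ y, ENNReal.ofReal (w x * w y * (v x - v y) ^ 2) * hsG t (x - y) := by
  have : Nonempty (Fin d) := ⟨⟨0, by omega⟩⟩
  set N := ENNReal.ofReal ((4 * Real.pi) ^ ((d:ℝ)/2)) with hN
  set A : EuclideanSpace ℝ (Fin d) → ℝ≥0∞ := fun x => ENNReal.ofReal (v x ^ 2 * w x) with hA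
  set W : EuclideanSpace ℝ (Fin d) → ℝ≥0∞ := fun x => ENNReal.ofReal (w x) with hW
  have mA : Measurable A := by fun_prop
  have mW : Measurable W := by fun_prop
  have mK := hsK_meas (b - 1)
  have hae : ∀ᵐ x : EuclideanSpace ℝ (Fin d), W x = hsR b x := by
    have : ∀ᵐ x : EuclideanSpace ℝ (Fin d), x ≠ 0 := by
      simp [ae_iff]
    filter_upwards [this] with x hx using hwR x hx
  have mG : Measurable (fun z : (EuclideanSpace ℝ (Fin d)) × EuclideanSpace ℝ (Fin d) =>
          hsG t (z.1 - z.2)) := hsG_meas' (d := d) (by fun_prop) (by fun_prop)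
  have mGx : ∀ x : EuclideanSpace ℝ (Fin d), Measurable (fun y => hsG t (x - y)) :=
    fun x => hsG_meas' (d := d) (by fun_prop) (by fun_prop)
  -- the four terms
  have T1 : ∫⁻ x, ∫⁻ y, (A x * W y) * hsG t (x - y) =
      N * hsPhi A b (fun τ => ENNReal.ofReal (hsK (b - 1) τ)) t := by
    rw [hsPhi, ← lintegral_const_mul' _ _ ENNReal.ofReal_ne_top]
    congr 1; ext x
    rw [mul_left_comm, ← hsR_heat b t ht x, ← lintegral_const_mul' _ _ ENNReal.ofReal_ne_top]
    refine lintegral_congr_ae ?_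
    filter_upwards [hae] with y hy
    rw [hy]; ring
  have T2 : ∫⁻ x, ∫⁻ y, (A y * W x) * hsG t (x - y) =
      N * hsPhi A b (fun τ => ENNReal.ofReal (hsK (b - 1) τ)) t := by
    rw [← T1, lintegral_lintegral_swap]
    · congr 1; ext x; congr 1; ext y; rw [hsG_symm]
    · refine Measurable.aemeasurable ?_
      simp only [Function.uncurry_def]
      fun_prop
  have Z0 : ∫⁻ x, A x * W x = hsPhi A b (fun _ => 1) t := by
    rw [hsPhi]
    refine lintegral_congr_ae ?_
    filter_upwards [hae] with x hx
    rw [hx, hsR]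
    simp
  have Z1 : ∫⁻ x, ∫⁻ y, (A x * W x) * hsG t (x - y) = N * hsPhi A b (fun _ => 1) t := by
    rw [← Z0, ← lintegral_const_mul' _ _ ENNReal.ofReal_ne_top]
    congr 1; ext x
    rw [lintegral_const_mul' _ _ (ENNReal.mul_ne_top ENNReal.ofReal_ne_top ENNReal.ofReal_ne_top),
      hsG_mass t ht x, mul_comm]
  have Z2 : ∫⁻ x, ∫⁻ y, (A y * W y) * hsG t (x - y) = N * hsPhi A b (fun _ => 1) t := by
    rw [← Z1, lintegral_lintegral_swap]
    · congr 1; ext x; congr 1; ext y; rw [hsG_symm]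
    · refine Measurable.aemeasurable ?_
      simp only [Function.uncurry_def]
      fun_prop
  have hpt : ∀ x y, ENNReal.ofReal ((v x * w x - v y * w y) ^ 2) + (A x * W y + A y * W x) =
      (A x * W x + A y * W y) + ENNReal.ofReal (w x * w y * (v x - v y) ^ 2) := by
    intro x y
    have h1 := hw0 x
    have h2 := hw0 y
    simp only [hA, hW]
    rw [← ENNReal.ofReal_mul (by positivity), ← ENNReal.ofReal_mul (by positivity),
      ← ENNReal.ofReal_mul (by positivity), ← ENNReal.ofReal_mul (by positivity),
      ← ENNReal.ofReal_add (by positivity) (by positivity),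
      ← ENNReal.ofReal_add (by positivity) (by positivity),
      ← ENNReal.ofReal_add (by positivity) (by positivity),
      ← ENNReal.ofReal_add (by positivity) (by positivity)]
    congr 1; ring
  have dbl_add : ∀ F H : EuclideanSpace ℝ (Fin d) × EuclideanSpace ℝ (Fin d) → ℝ≥0∞,
      Measurable F → Measurable H →
      ∫⁻ x, ∫⁻ y, (F (x, y) + H (x, y)) * hsG t (x - y) =
      (∫⁻ x, ∫⁻ y, F (x, y) * hsG t (x - y)) + ∫⁻ x, ∫⁻ y, H (x, y) * hsG t (x - y) := by
    intro F H hF hH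
    have m : Measurable (fun x : EuclideanSpace ℝ (Fin d) => ∫⁻ y, F (x, y) * hsG t (x - y)) :=
      Measurable.lintegral_prod_right' (f := fun z : EuclideanSpace ℝ (Fin d) ×
        EuclideanSpace ℝ (Fin d) => F z * hsG t (z.1 - z.2)) (by fun_prop)
    rw [← lintegral_add_left m]
    congr 1; ext x
    have := mGx x
    rw [← lintegral_add_left (by fun_prop)]
    congr 1; ext y; ring
  have big : (∫⁻ x, ∫⁻ y, ENNReal.ofReal ((v x * w x - v y * w y) ^ 2) * hsG t (x - y)) +
      (N * hsPhi A b (fun τ => ENNReal.ofReal (hsK (b - 1) τ)) t +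
        N * hsPhi A b (fun τ => ENNReal.ofReal (hsK (b - 1) τ)) t) =
      (N * hsPhi A b (fun _ => 1) t + N * hsPhi A b (fun _ => 1) t) +
      ∫⁻ x, ∫⁻ y, ENNReal.ofReal (w x * w y * (v x - v y) ^ 2) * hsG t (x - y) := by
    have e1 := dbl_add (fun z => A z.1 * W z.2) (fun z => A z.2 * W z.1) (by fun_prop) (by fun_prop)
    have e2 := dbl_add (fun z => A z.1 * W z.1) (fun z => A z.2 * W z.2) (by fun_prop) (by fun_prop)
    have e3 := dbl_add (fun z => ENNReal.ofReal ((v z.1 * w z.1 - v z.2 * w z.2) ^ 2))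
      (fun z => A z.1 * W z.2 + A z.2 * W z.1) (by fun_prop) (by fun_prop)
    have e4 := dbl_add (fun z => A z.1 * W z.1 + A z.2 * W z.2)
      (fun z => ENNReal.ofReal (w z.1 * w z.2 * (v z.1 - v z.2) ^ 2)) (by fun_prop) (by fun_prop)
    simp only at e1 e2 e3 e4
    rw [T1, T2] at e1
    rw [Z1, Z2] at e2
    rw [e1] at e3
    rw [e2] at e4
    rw [← e3, ← e4]
    simp_rw [hpt]
  -- cancel the common part
  have c1 : hsPhi A b (fun τ => ENNReal.ofReal (hsK (b - 1) τ)) t =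
      hsPhi A b (fun τ => ENNReal.ofReal (hsK (b - 1) τ - 1)) t +
      hsPhi A b (fun τ => ENNReal.ofReal (min 1 (hsK (b - 1) τ))) t := by
    rw [← hsPhi_add A mA b _ _ (by fun_prop) t]
    congr 1; ext τ
    have := hsK_nonneg (b - 1) τ
    rcases le_total 1 (hsK (b - 1) τ) with h | h
    · rw [min_eq_left h, ← ENNReal.ofReal_add (by linarith) (by linarith)]; congr 1; ring
    · rw [min_eq_right h, ENNReal.ofReal_of_nonpos (by linarith : hsK (b - 1) τ - 1 ≤ 0), zero_add]
  have c2 : hsPhi A b (fun _ => 1) t =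
      hsPhi A b (fun τ => ENNReal.ofReal (1 - hsK (b - 1) τ)) t +
      hsPhi A b (fun τ => ENNReal.ofReal (min 1 (hsK (b - 1) τ))) t := by
    rw [← hsPhi_add A mA b _ _ (by fun_prop) t]
    congr 1; ext τ
    have := hsK_nonneg (b - 1) τ
    rcases le_total 1 (hsK (b - 1) τ) with h | h
    · rw [min_eq_left h, ENNReal.ofReal_of_nonpos (by linarith : 1 - hsK (b - 1) τ ≤ 0), zero_add,
        ENNReal.ofReal_one]
    · rw [min_eq_right h, ← ENNReal.ofReal_add (by linarith) (by linarith)]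
      simp
  have fM : hsPhi A b (fun τ => ENNReal.ofReal (min 1 (hsK (b - 1) τ))) t ≠ ⊤ := by
    refine ne_top_of_le_ne_top hfin ?_
    rw [show (∫⁻ x, ENNReal.ofReal (v x ^ 2 * w x) * ENNReal.ofReal (w x)) = _ from Z0, c2]
    exact le_add_self
  have fM2 : 2 * (N * hsPhi A b (fun τ => ENNReal.ofReal (min 1 (hsK (b - 1) τ))) t) ≠ ⊤ :=
    ENNReal.mul_ne_top (by simp) (ENNReal.mul_ne_top ENNReal.ofReal_ne_top fM)
  rw [c1, c2] at big
  refine (ENNReal.add_left_inj fM2).1 ?_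
  calc _ = _ := by ring
    _ = _ := big
    _ = _ := by ring

lemma hs_ground {d : ℕ} (hd : 2 ≤ d) (σ b : ℝ) (h0 : 0 < σ) (h1 : σ < 1) (hb : σ < b)
    (v w : EuclideanSpace ℝ (Fin d) → ℝ)
    (hv : Measurable v) (hw : Measurable w) (hw0 : ∀ x, 0 ≤ w x)
    (hwR : ∀ x, x ≠ 0 → ENNReal.ofReal (w x) = hsR b x)
    (hfin : ∫⁻ x, ENNReal.ofReal (v x ^ 2 * w x) * ENNReal.ofReal (w x) ≠ ⊤)
    (hfinJ : ∫⁻ x, ENNReal.ofReal (v x ^ 2 * w x) * hsR (b + -σ) x ≠ ⊤) :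
    (∫⁻ x, ∫⁻ y, ENNReal.ofReal ((v x * w x - v y * w y) ^ 2) * hsR (-σ) (x - y)) =
      2 * (ENNReal.ofReal ((4 * Real.pi) ^ ((d:ℝ)/2)) *
        (ENNReal.ofReal (Real.Gamma (1 - σ) * Real.Gamma b / (σ * Real.Gamma (b - σ))) *
          ∫⁻ x, ENNReal.ofReal (v x ^ 2 * w x) * hsR (b + -σ) x)) +
      ∫⁻ x, ∫⁻ y, ENNReal.ofReal (w x * w y * (v x - v y) ^ 2) * hsR (-σ) (x - y) := by
  obtain ⟨hC, hC2⟩ := hs_const σ b h0 h1 hb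
  set N := ENNReal.ofReal ((4 * Real.pi) ^ ((d:ℝ)/2)) with hN
  set A : EuclideanSpace ℝ (Fin d) → ℝ≥0∞ := fun x => ENNReal.ofReal (v x ^ 2 * w x) with hA
  have mA : Measurable A := by fun_prop
  have mK := hsK_meas (b - 1)
  have mPhi : ∀ f : ℝ → ℝ≥0∞, Measurable f → Measurable (hsPhi A b f) := by
    intro f hf
    have m := hsPhi_inner_meas (d := d) b f hf
    exact Measurable.lintegral_prod_left' (f := fun z : EuclideanSpace ℝ (Fin d) × ℝ => A z.1 *
      ∫⁻ s in Set.Ioi (0:ℝ), ENNReal.ofReal (s ^ (b - 1)) * (f (z.2 / s) * hsG s z.1)) (by fun_prop)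
  have mM := mPhi (fun τ => ENNReal.ofReal (hsK (b - 1) τ - 1)) (by fun_prop)
  have mP := mPhi (fun τ => ENNReal.ofReal (1 - hsK (b - 1) τ)) (by fun_prop)
  have key : ∫⁻ t in Set.Ioi (0:ℝ), ENNReal.ofReal (t ^ (-σ - 1)) *
      ((∫⁻ x, ∫⁻ y, ENNReal.ofReal ((v x * w x - v y * w y) ^ 2) * hsG t (x - y)) +
      2 * (N * hsPhi A b (fun τ => ENNReal.ofReal (hsK (b - 1) τ - 1)) t)) =
      ∫⁻ t in Set.Ioi (0:ℝ), ENNReal.ofReal (t ^ (-σ - 1)) *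
      (2 * (N * hsPhi A b (fun τ => ENNReal.ofReal (1 - hsK (b - 1) τ)) t) +
      ∫⁻ x, ∫⁻ y, ENNReal.ofReal (w x * w y * (v x - v y) ^ 2) * hsG t (x - y)) :=
    setLIntegral_congr_fun measurableSet_Ioi (fun t ht => by
      rw [hs_ground_t hd b v w hv hw hw0 hwR hfin t ht])
  simp_rw [mul_add] at key
  rw [lintegral_add_right _ (by fun_prop), lintegral_add_left (by fun_prop)] at key
  have s1 := hs_dbl (d := d) (-σ) (fun z => ENNReal.ofReal ((v z.1 * w z.1 - v z.2 * w z.2) ^ 2))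
    (by fun_prop)
  have s2 := hs_dbl (d := d) (-σ) (fun z => ENNReal.ofReal (w z.1 * w z.2 * (v z.1 - v z.2) ^ 2))
    (by fun_prop)
  simp only at s1 s2
  rw [s1, s2] at key
  have cm : ∀ f : ℝ → ℝ≥0∞, Measurable f →
      ∫⁻ t in Set.Ioi (0:ℝ), ENNReal.ofReal (t ^ (-σ - 1)) * (2 * (N * hsPhi A b f t)) =
      2 * (N * ((∫⁻ t in Set.Ioi (0:ℝ), ENNReal.ofReal (t ^ (-σ - 1)) * f t) *
        ∫⁻ x, A x * hsR (b + -σ) x)) := by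
    intro f hf
    rw [← hsPhi_mellin A mA b (-σ) f hf, ← lintegral_const_mul' _ _ ENNReal.ofReal_ne_top,
      ← lintegral_const_mul' _ _ (by simp)]
    congr 1; ext t; ring
  rw [cm _ (by fun_prop), cm _ (by fun_prop), hC2] at key
  have fin2 : 2 * (N * ((∫⁻ t in Set.Ioi (0:ℝ), ENNReal.ofReal (t ^ (-σ - 1)) *
      ENNReal.ofReal (hsK (b - 1) t - 1)) * ∫⁻ x, A x * hsR (b + -σ) x)) ≠ ⊤ :=
    ENNReal.mul_ne_top (by simp) (ENNReal.mul_ne_top ENNReal.ofReal_ne_top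
      (ENNReal.mul_ne_top hC hfinJ))
  refine (ENNReal.add_left_inj fin2).1 ?_
  rw [key]; ring

lemma hs_log (a c : ℝ) (ha : 0 < a) (hc : 0 < c) :
    (Real.log a - Real.log c) ^ 2 ≤ (a - c) ^ 2 / (a * c) := by
  wlog h : c ≤ a generalizing a c
  · have := this c a hc ha (le_of_not_ge h)
    calc _ = (Real.log c - Real.log a) ^ 2 := by ring
      _ ≤ _ := this
      _ = _ := by rw [mul_comm c a]; ring
  have hl : Real.log c ≤ Real.log a := Real.log_le_log hc h
  set x := (Real.log a - Real.log c) / 2 with hx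
  have hx0 : 0 ≤ x := by rw [hx]; linarith
  have hs : x ≤ Real.sinh x := Real.self_le_sinh_iff.2 hx0
  have h2 : x ^ 2 ≤ Real.sinh x ^ 2 := by gcongr
  have e1 : Real.exp x * Real.exp x = a / c := by
    rw [← Real.exp_add, hx, show (Real.log a - Real.log c) / 2 + (Real.log a - Real.log c) / 2
      = Real.log a - Real.log c by ring, Real.exp_sub, Real.exp_log ha, Real.exp_log hc]
  have e2 : Real.exp (-x) * Real.exp (-x) = c / a := by
    rw [← Real.exp_add, hx, show -((Real.log a - Real.log c) / 2) + -((Real.log a - Real.log c) / 2)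
      = Real.log c - Real.log a by ring, Real.exp_sub, Real.exp_log ha, Real.exp_log hc]
  have e3 : Real.exp x * Real.exp (-x) = 1 := by rw [← Real.exp_add]; simp
  have e4 : 4 * Real.sinh x ^ 2 = (a - c) ^ 2 / (a * c) := by
    rw [Real.sinh_eq]
    have : (a - c) ^ 2 / (a * c) = a / c + c / a - 2 := by field_simp; ring
    rw [this]
    linear_combination e1 + e2 - 2 * e3
  rw [← e4]
  have : Real.log a - Real.log c = 2 * x := by rw [hx]; ring
  rw [this]; nlinarith

lemma hs_rem {d : ℕ} (hd : 2 ≤ d) (σ b : ℝ) (h0 : 0 < σ) (h1 : σ < 1)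
    (hb : b = (d + 2 * σ) / 4) :
    ∃ A : ℝ, 0 ≤ A ∧ ∀ x : EuclideanSpace ℝ (Fin d), x ≠ 0 →
      ∫⁻ y : EuclideanSpace ℝ (Fin d), ENNReal.ofReal (‖x‖ ^ (2 * b - d - 1) * ‖y‖ ^ (2 * b - d - 1) *
        ‖x - y‖ ^ (2 * (1 - σ) - d)) ≤ ENNReal.ofReal A * ENNReal.ofReal (‖x‖ ^ (-(d:ℝ))) := by
  have hd' : (2:ℝ) ≤ d := by exact_mod_cast hd
  have : Nonempty (Fin d) := ⟨⟨0, by omega⟩⟩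
  set B := ∫⁻ t in Set.Ioi (0:ℝ), ENNReal.ofReal (t ^ ((1 - σ) - 1)) *
    ENNReal.ofReal (hsK ((b - 1/2) - 1) t) with hB
  have hBt : B ≠ ⊤ := hs_betaK (1 - σ) (b - 1/2) (by linarith) (by rw [hb]; linarith)
  set k : ℝ → ℝ := fun q => 4 ^ ((d:ℝ)/2 - q) * Real.Gamma ((d:ℝ)/2 - q) with hk
  have kpos : ∀ q, q < (d:ℝ)/2 → 0 < k q := fun q hq =>
    mul_pos (Real.rpow_pos_of_pos (by norm_num) _) (Real.Gamma_pos_of_pos (by linarith))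
  have q1 : b - 1/2 < (d:ℝ)/2 := by rw [hb]; linarith
  have q2 : 1 - σ < (d:ℝ)/2 := by linarith
  have q3 : (b - 1/2) + (1 - σ) < (d:ℝ)/2 := by rw [hb]; linarith
  have k1 := kpos _ q1
  have k2 := kpos _ q2
  have k3 := kpos _ q3
  set N : ℝ := (4 * Real.pi) ^ ((d:ℝ)/2) with hN
  have hNp : 0 ≤ N := by positivity
  refine ⟨(k (b - 1/2))⁻¹ * (k (1 - σ))⁻¹ * (N * B.toReal * k ((b - 1/2) + (1 - σ))), by positivity, ?_⟩
  intro x hx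
  have hx' : 0 < ‖x‖ := norm_pos_iff.2 hx
  have hpt : ∀ᵐ y : EuclideanSpace ℝ (Fin d), ENNReal.ofReal (‖x‖ ^ (2 * b - d - 1) *
      ‖y‖ ^ (2 * b - d - 1) * ‖x - y‖ ^ (2 * (1 - σ) - d)) =
      ENNReal.ofReal (‖x‖ ^ (2 * b - d - 1) * ((k (b - 1/2))⁻¹ * (k (1 - σ))⁻¹)) *
      (hsR (1 - σ) (x - y) * hsR (b - 1/2) y) := by
    have a1 : ∀ᵐ y : EuclideanSpace ℝ (Fin d), y ≠ 0 := by simp [ae_iff]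
    have a2 : ∀ᵐ y : EuclideanSpace ℝ (Fin d), y ≠ x := by simp [ae_iff]
    filter_upwards [a1, a2] with y hy hyx
    rw [hsR_eq _ q2 _ (sub_ne_zero.2 (Ne.symm hyx)), hsR_eq _ q1 _ hy,
      ← ENNReal.ofReal_mul (by positivity), ← ENNReal.ofReal_mul (by positivity)]
    congr 1
    change _ = _ * (k (1 - σ) * _ * (k (b - 1/2) * _))
    rw [show 2 * (b - 1/2) - (d:ℝ) = 2 * b - d - 1 by ring]
    generalize k (b - 1/2) = c1 at k1 ⊢
    generalize k (1 - σ) = c2 at k2 ⊢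
    field_simp
  rw [lintegral_congr_ae hpt, lintegral_const_mul' _ _ ENNReal.ofReal_ne_top, hs_riesz,
    hsR_eq _ q3 _ hx, ← hB, ← ENNReal.ofReal_toReal hBt, ← ENNReal.ofReal_mul (by positivity),
    ← ENNReal.ofReal_mul (by positivity), ← ENNReal.ofReal_mul (by positivity),
    ← ENNReal.ofReal_mul (by positivity)]
  refine le_of_eq ?_
  congr 1
  change _ * (_ * (_ * (k (b - 1/2 + (1 - σ)) * _))) = _
  rw [ENNReal.toReal_ofReal ENNReal.toReal_nonneg]
  have : ‖x‖ ^ (-(d:ℝ)) = ‖x‖ ^ (2 * b - d - 1) * ‖x‖ ^ (2 * (b - 1/2 + (1 - σ)) - d) := by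
    rw [← Real.rpow_add hx']; congr 1; rw [hb]; ring
  rw [this]; ring

def hsQ {d : ℕ} (σ b : ℝ) (x y : EuclideanSpace ℝ (Fin d)) : ℝ≥0∞ :=
  ENNReal.ofReal (‖x‖ ^ (2 * b - d - 1) * ‖y‖ ^ (2 * b - d - 1) *
        ‖x - y‖ ^ (2 * (1 - σ) - d))

lemma hsQ_meas {d : ℕ} (σ b : ℝ) : Measurable (fun z : EuclideanSpace ℝ (Fin d) ×
    EuclideanSpace ℝ (Fin d) => hsQ σ b z.1 z.2) := by
  unfold hsQ; fun_prop

lemma hsQ_symm {d : ℕ} (σ b : ℝ) (x y : EuclideanSpace ℝ (Fin d)) : hsQ σ b x y = hsQ σ b y x := by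
  unfold hsQ
  rw [norm_sub_rev x y, mul_comm (‖x‖ ^ (2 * b - d - 1))]

lemma hs_rem_pt1 (k0 M k1 nx ny nz e r q v : ℝ) (hk0 : 0 ≤ k0) (hk1 : 0 ≤ k1)
    (hx' : 0 < nx) (hy' : 0 < ny) (hz : 0 < nz) (hq : q = r + 2)
    (hv1 : v ^ 2 ≤ M * (nz ^ 2 / (nx * ny))) :
    (k0 * nx ^ e) * (k0 * ny ^ e) * v ^ 2 * (k1 * nz ^ r) ≤
      (k0 ^ 2 * M * k1) * (nx ^ (e - 1) * ny ^ (e - 1) * nz ^ q) := by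
  calc _ ≤ (k0 * nx ^ e) * (k0 * ny ^ e) * (M * (nz ^ 2 / (nx * ny))) * (k1 * nz ^ r) := by
        gcongr
    _ = _ := by
        rw [hq, Real.rpow_sub_one hx'.ne', Real.rpow_sub_one hy'.ne', Real.rpow_add hz r 2]
        rw [Real.rpow_two]
        field_simp

lemma hs_rem_pt {d : ℕ} (hd : 2 ≤ d) (σ b : ℝ) (h0 : 0 < σ) (k1 : ℝ)
    (hk1 : k1 = 4 ^ ((d:ℝ)/2 - -σ) * Real.Gamma ((d:ℝ)/2 - -σ)) (k1pos : 0 < k1)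
    (v : EuclideanSpace ℝ (Fin d) → ℝ) (S : Set (EuclideanSpace ℝ (Fin d)))
    (k0 M : ℝ) (hk0 : 0 ≤ k0) (hM : 0 ≤ M)
    (hv : ∀ x y, x ≠ 0 → y ≠ 0 → (v x - v y) ^ 2 ≤ M * ((‖x‖ - ‖y‖) ^ 2 / (‖x‖ * ‖y‖)))
    (hvS : ∀ x, x ≠ 0 → x ∉ S → v x = 0) (x y : EuclideanSpace ℝ (Fin d)) (hx : x ≠ 0) (hy : y ≠ 0) :
      ENNReal.ofReal ((k0 * ‖x‖ ^ (2 * b - d)) * (k0 * ‖y‖ ^ (2 * b - d)) * (v x - v y) ^ 2) *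
          hsR (-σ) (x - y) ≤ ENNReal.ofReal (k0 ^ 2 * M * k1) *
          (S.indicator (fun _ => 1) x * hsQ σ b x y + S.indicator (fun _ => 1) y * hsQ σ b x y) := by
  have hd' : (2:ℝ) ≤ d := by exact_mod_cast hd
  by_cases hxy : x = y
  · subst hxy; simp
  by_cases hSS : x ∉ S ∧ y ∉ S
  · rw [hvS x hx hSS.1, hvS y hy hSS.2]; simp
  have hone : (1:ℝ≥0∞) ≤ S.indicator (fun _ => 1) x + S.indicator (fun _ => 1) y := by
    by_cases hxS : x ∈ S
    · simp [hxS]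
    · have hyS : y ∈ S := by tauto
      simp [hyS]
  have hx' : 0 < ‖x‖ := norm_pos_iff.2 hx
  have hy' : 0 < ‖y‖ := norm_pos_iff.2 hy
  have hz : 0 < ‖x - y‖ := norm_pos_iff.2 (sub_ne_zero.2 hxy)
  have hv1 : (v x - v y) ^ 2 ≤ M * (‖x - y‖ ^ 2 / (‖x‖ * ‖y‖)) := by
    refine (hv x y hx hy).trans ?_
    have : (‖x‖ - ‖y‖) ^ 2 ≤ ‖x - y‖ ^ 2 := by
      rw [← sq_abs]
      have := abs_norm_sub_norm_le x y
      gcongr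
    gcongr
  rw [← add_mul]
  refine le_trans ?_ (mul_le_mul_right (mul_le_mul_left hone _) _)
  rw [one_mul, hsR_eq (-σ) (by linarith) _ (sub_ne_zero.2 hxy), hsQ, ← hk1,
    ← ENNReal.ofReal_mul (by positivity), ← ENNReal.ofReal_mul (by positivity)]
  apply ENNReal.ofReal_le_ofReal
  exact hs_rem_pt1 k0 M k1 _ _ _ _ _ _ _ hk0 k1pos.le hx' hy' hz (by ring) hv1

lemma hs_rem_int {d : ℕ} (hd : 2 ≤ d) (σ b A : ℝ) (S : Set (EuclideanSpace ℝ (Fin d)))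
    (hS : MeasurableSet S) (hAx : ∀ x : EuclideanSpace ℝ (Fin d), x ≠ 0 →
      ∫⁻ y : EuclideanSpace ℝ (Fin d), hsQ σ b x y ≤
        ENNReal.ofReal A * ENNReal.ofReal (‖x‖ ^ (-(d:ℝ)))) :
    ∫⁻ x, ∫⁻ y, (S.indicator (fun _ => 1) x * hsQ σ b x y + S.indicator (fun _ => 1) y * hsQ σ b x y) ≤
      2 * (ENNReal.ofReal A * ∫⁻ x in S, ENNReal.ofReal (‖x‖ ^ (-(d:ℝ)))) := by
  have : Nonempty (Fin d) := ⟨⟨0, by omega⟩⟩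
  have ae0 : ∀ᵐ y : EuclideanSpace ℝ (Fin d), y ≠ 0 := by simp [ae_iff]
  have mI : Measurable (S.indicator (fun _ : EuclideanSpace ℝ (Fin d) => (1 : ℝ≥0∞))) :=
    measurable_const.indicator hS
  have mQ := hsQ_meas (d := d) σ b
  have mx : ∀ x : EuclideanSpace ℝ (Fin d), Measurable (fun y => hsQ σ b x y) :=
    fun x => by unfold hsQ; fun_prop
  have s1 : ∫⁻ x, ∫⁻ y, S.indicator (fun _ => 1) x * hsQ σ b x y ≤
      ENNReal.ofReal A * ∫⁻ x in S, ENNReal.ofReal (‖x‖ ^ (-(d:ℝ))) := by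
    rw [← lintegral_indicator hS, ← lintegral_const_mul' _ _ ENNReal.ofReal_ne_top]
    refine lintegral_mono_ae ?_
    filter_upwards [ae0] with x hx
    rw [lintegral_const_mul _ (mx x)]
    by_cases hxS : x ∈ S
    · simp only [Set.indicator_of_mem hxS, one_mul]
      exact hAx x hx
    · simp [hxS]
  have m1 : Measurable (fun z : EuclideanSpace ℝ (Fin d) × EuclideanSpace ℝ (Fin d) =>
    S.indicator (fun _ => 1) z.1 * hsQ σ b z.1 z.2) := (mI.comp measurable_fst).mul mQ
  have m2 : Measurable (fun z : EuclideanSpace ℝ (Fin d) × EuclideanSpace ℝ (Fin d) =>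
    S.indicator (fun _ => 1) z.2 * hsQ σ b z.1 z.2) := (mI.comp measurable_snd).mul mQ
  have s2 : ∫⁻ x, ∫⁻ y, S.indicator (fun _ => 1) y * hsQ σ b x y = ∫⁻ x, ∫⁻ y, S.indicator (fun _ => 1) x * hsQ σ b x y := by
    rw [lintegral_lintegral_swap m2.aemeasurable]
    refine lintegral_congr fun x => lintegral_congr fun y => ?_
    rw [hsQ_symm]
  have s3 : ∫⁻ x, ∫⁻ y, (S.indicator (fun _ => 1) x * hsQ σ b x y + S.indicator (fun _ => 1) y * hsQ σ b x y) =
      (∫⁻ x, ∫⁻ y, S.indicator (fun _ => 1) x * hsQ σ b x y) + ∫⁻ x, ∫⁻ y, S.indicator (fun _ => 1) y * hsQ σ b x y := by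
    have m3 : Measurable (fun x => ∫⁻ y, S.indicator (fun _ => 1) x * hsQ σ b x y) :=
      m1.lintegral_prod_right'
    rw [← lintegral_add_left m3]
    refine lintegral_congr fun x => ?_
    rw [← lintegral_add_left ((mx x).const_mul _)]
  rw [s3, s2, ← two_mul]
  gcongr

lemma hs_rem2 {d : ℕ} (hd : 2 ≤ d) (σ b : ℝ) (h0 : 0 < σ) (h1 : σ < 1)
    (hb : b = (d + 2 * σ) / 4) :
    ∃ A : ℝ, 0 ≤ A ∧ ∀ (v : EuclideanSpace ℝ (Fin d) → ℝ) (S : Set (EuclideanSpace ℝ (Fin d)))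
      (k0 M : ℝ), MeasurableSet S → 0 ≤ k0 → 0 ≤ M →
      (∀ x y, x ≠ 0 → y ≠ 0 → (v x - v y) ^ 2 ≤ M * ((‖x‖ - ‖y‖) ^ 2 / (‖x‖ * ‖y‖))) →
      (∀ x, x ≠ 0 → x ∉ S → v x = 0) →
      ∫⁻ x : EuclideanSpace ℝ (Fin d), ∫⁻ y : EuclideanSpace ℝ (Fin d),
        ENNReal.ofReal ((k0 * ‖x‖ ^ (2 * b - d)) * (k0 * ‖y‖ ^ (2 * b - d)) * (v x - v y) ^ 2) *
          hsR (-σ) (x - y) ≤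
      ENNReal.ofReal (k0 ^ 2 * M * A) * ∫⁻ x in S, ENNReal.ofReal (‖x‖ ^ (-(d:ℝ))) := by
  obtain ⟨A, hA, hAx⟩ := hs_rem hd σ b h0 h1 hb
  have hd' : (2:ℝ) ≤ d := by exact_mod_cast hd
  have : Nonempty (Fin d) := ⟨⟨0, by omega⟩⟩
  obtain ⟨k1, hk1⟩ : ∃ k1 : ℝ, k1 = 4 ^ ((d:ℝ)/2 - -σ) * Real.Gamma ((d:ℝ)/2 - -σ) := ⟨_, rfl⟩
  have k1pos : 0 < k1 := by
    rw [hk1]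
    exact mul_pos (Real.rpow_pos_of_pos (by norm_num) _) (Real.Gamma_pos_of_pos (by linarith))
  refine ⟨2 * k1 * A, by positivity, ?_⟩
  intro v S k0 M hS hk0 hM hv hvS
  have ae0 : ∀ᵐ y : EuclideanSpace ℝ (Fin d), y ≠ 0 := by simp [ae_iff]
  have pt := hs_rem_pt hd σ b h0 k1 hk1 k1pos v S k0 M hk0 hM hv hvS
  have step1 : ∫⁻ x : EuclideanSpace ℝ (Fin d), ∫⁻ y : EuclideanSpace ℝ (Fin d),
        ENNReal.ofReal ((k0 * ‖x‖ ^ (2 * b - d)) * (k0 * ‖y‖ ^ (2 * b - d)) * (v x - v y) ^ 2) *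
          hsR (-σ) (x - y) ≤
      ENNReal.ofReal (k0 ^ 2 * M * k1) *
        ∫⁻ x, ∫⁻ y, (S.indicator (fun _ => 1) x * hsQ σ b x y + S.indicator (fun _ => 1) y * hsQ σ b x y) := by
    rw [← lintegral_const_mul' _ _ ENNReal.ofReal_ne_top]
    refine lintegral_mono_ae ?_
    filter_upwards [ae0] with x hx
    rw [← lintegral_const_mul' _ _ ENNReal.ofReal_ne_top]
    refine lintegral_mono_ae ?_
    filter_upwards [ae0] with y hy
    exact pt x y hx hy
  refine step1.trans ((mul_le_mul_right (hs_rem_int hd σ b A S hS hAx) _).trans (le_of_eq ?_))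
  rw [show k0 ^ 2 * M * (2 * k1 * A) = (k0 ^ 2 * M * k1) * (2 * A) by ring,
    ENNReal.ofReal_mul (p := k0 ^ 2 * M * k1) (by positivity), ENNReal.ofReal_mul (p := 2) (by norm_num)]
  rw [ENNReal.ofReal_ofNat]
  ring

/-- Logarithmic annuli. -/
def hsT (d : ℕ) (a c : ℝ) : Set (EuclideanSpace ℝ (Fin d)) :=
  {x | x ≠ 0 ∧ a ≤ Real.log ‖x‖ ∧ Real.log ‖x‖ ≤ c}

lemma hsT_meas (d : ℕ) (a c : ℝ) : MeasurableSet (hsT d a c) := by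
  have hm : Measurable (fun x : EuclideanSpace ℝ (Fin d) => Real.log ‖x‖) := by fun_prop
  have : hsT d a c = {0}ᶜ ∩ ({x | a ≤ Real.log ‖x‖} ∩ {x | Real.log ‖x‖ ≤ c}) := by
    ext x; simp [hsT]
  rw [this]
  exact (measurableSet_singleton _).compl.inter
    ((measurableSet_le measurable_const hm).inter (measurableSet_le hm measurable_const))

lemma hsT_scale (d : ℕ) (a c h : ℝ) :
    ∫⁻ x in hsT d (a + h) (c + h), ENNReal.ofReal (‖x‖ ^ (-(d:ℝ))) =
      ∫⁻ x in hsT d a c, ENNReal.ofReal (‖x‖ ^ (-(d:ℝ))) := by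
  set r := Real.exp h with hr
  have hr0 : 0 < r := Real.exp_pos h
  rw [← lintegral_indicator (hsT_meas d _ _), ← lintegral_indicator (hsT_meas d _ _)]
  set F : EuclideanSpace ℝ (Fin d) → ℝ≥0∞ := (hsT d (a + h) (c + h)).indicator
    (fun x => ENNReal.ofReal (‖x‖ ^ (-(d:ℝ)))) with hF
  have mF : Measurable F := Measurable.indicator (by fun_prop) (hsT_meas d _ _)
  have key : ∫⁻ x, F (r • x) = ENNReal.ofReal |(r ^ d)⁻¹| * ∫⁻ x, F x := by
    rw [← lintegral_map mF (measurable_const_smul r), Measure.map_addHaar_smul volume hr0.ne',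
      lintegral_smul_measure, finrank_euclideanSpace_fin, smul_eq_mul]
  have pt : ∀ x, F (r • x) = ENNReal.ofReal |(r ^ d)⁻¹| * (hsT d a c).indicator
      (fun x => ENNReal.ofReal (‖x‖ ^ (-(d:ℝ)))) x := by
    intro x
    have hmem : r • x ∈ hsT d (a + h) (c + h) ↔ x ∈ hsT d a c := by
      by_cases hx : x = 0
      · simp [hsT, hx]
      · have hx' : ‖x‖ ≠ 0 := norm_ne_zero_iff.2 hx
        have : Real.log ‖r • x‖ = Real.log ‖x‖ + h := by
          rw [norm_smul, Real.norm_of_nonneg hr0.le, Real.log_mul hr0.ne' hx', hr, Real.log_exp, add_comm]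
        simp only [hsT, Set.mem_ofPred_eq, this, add_le_add_iff_right, ne_eq, smul_eq_zero, hr0.ne',
          false_or]
    by_cases hx : x ∈ hsT d a c
    · rw [hF, Set.indicator_of_mem (hmem.2 hx), Set.indicator_of_mem hx,
        ← ENNReal.ofReal_mul (abs_nonneg _), norm_smul, Real.norm_of_nonneg hr0.le,
        Real.mul_rpow hr0.le (norm_nonneg _), abs_of_pos (by positivity), Real.rpow_neg hr0.le,
        Real.rpow_natCast]
    · rw [hF, Set.indicator_of_notMem (fun h => hx (hmem.1 h)), Set.indicator_of_notMem hx, mul_zero]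
  simp_rw [pt] at key
  rw [lintegral_const_mul' _ _ ENNReal.ofReal_ne_top] at key
  have hc0 : ENNReal.ofReal |(r ^ d)⁻¹| ≠ 0 := by
    rw [ne_eq, ENNReal.ofReal_eq_zero, not_le]; positivity
  exact ((ENNReal.mul_right_inj hc0 ENNReal.ofReal_ne_top).1 key).symm

lemma hsT_double (d : ℕ) (R : ℝ) :
    ∫⁻ x in hsT d (-(2 * R)) (2 * R), ENNReal.ofReal (‖x‖ ^ (-(d:ℝ))) ≤
      2 * ∫⁻ x in hsT d (-R) R, ENNReal.ofReal (‖x‖ ^ (-(d:ℝ))) := by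
  have hsub : hsT d (-(2 * R)) (2 * R) ⊆ hsT d (-R + -R) (R + -R) ∪ hsT d (-R + R) (R + R) := by
    intro x hx
    obtain ⟨h0, h1, h2⟩ := hx
    rcases le_total (Real.log ‖x‖) 0 with h | h
    · exact Or.inl ⟨h0, by linarith, by linarith⟩
    · exact Or.inr ⟨h0, by linarith, by linarith⟩
  refine (lintegral_mono_set hsub).trans ((lintegral_union_le _ _ _).trans (le_of_eq ?_))
  rw [hsT_scale, hsT_scale, two_mul]

lemma hsT_le {d : ℕ} {a c : ℝ} {x : EuclideanSpace ℝ (Fin d)} (hx : x ∈ hsT d a c) :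
    Real.exp a ≤ ‖x‖ ∧ ‖x‖ ≤ Real.exp c := by
  have := norm_pos_iff.2 hx.1
  exact ⟨(Real.le_log_iff_exp_le this).1 hx.2.1, (Real.log_le_iff_le_exp this).1 hx.2.2⟩

lemma hsT_fin (d : ℕ) (a c e : ℝ) :
    ∫⁻ x in hsT d a c, ENNReal.ofReal (‖x‖ ^ e) ≠ ⊤ := by
  have hsub : hsT d a c ⊆ Metric.closedBall 0 (Real.exp c) := by
    intro x hx; simpa using (hsT_le hx).2
  have hb : ∀ x ∈ hsT d a c, ENNReal.ofReal (‖x‖ ^ e) ≤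
      ENNReal.ofReal (Real.exp (|e| * max |a| |c|)) := by
    intro x hx
    apply ENNReal.ofReal_le_ofReal
    rw [Real.rpow_def_of_pos (norm_pos_iff.2 hx.1)]
    apply Real.exp_le_exp.2
    refine (le_abs_self _).trans ?_
    rw [abs_mul, mul_comm]
    gcongr
    exact abs_le_max_abs_abs hx.2.1 hx.2.2
  refine ((setLIntegral_mono' (hsT_meas d a c) hb).trans_lt ?_).ne
  rw [setLIntegral_const]
  exact ENNReal.mul_lt_top ENNReal.ofReal_lt_top
    ((measure_mono hsub).trans_lt measure_closedBall_lt_top)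

/-- Smooth bump on the line. -/
def hsF : ContDiffBump (0 : ℝ) := ⟨1, 2, by norm_num, by norm_num⟩

/-- Logarithmic cutoff. -/
def hsV (d : ℕ) (R : ℝ) (x : EuclideanSpace ℝ (Fin d)) : ℝ := hsF (Real.log ‖x‖ / R)

lemma hsV_meas (d : ℕ) (R : ℝ) : Measurable (hsV d R) := by
  have h1 : Measurable (fun t => hsF t) := hsF.continuous.measurable
  have h2 : Measurable (fun x : EuclideanSpace ℝ (Fin d) => Real.log ‖x‖ / R) := by fun_prop
  exact h1.comp h2

lemma hsV_one (d : ℕ) (R : ℝ) (hR : 0 < R) (x : EuclideanSpace ℝ (Fin d))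
    (hx : x ∈ hsT d (-R) R) : hsV d R x = 1 := by
  apply hsF.one_of_mem_closedBall
  rw [mem_closedBall_zero_iff, Real.norm_eq_abs, abs_div, abs_of_pos hR, div_le_iff₀ hR]
  change _ ≤ 1 * R
  rw [one_mul, abs_le]; exact hx.2

lemma hsV_zero (d : ℕ) (R : ℝ) (hR : 0 < R) (x : EuclideanSpace ℝ (Fin d))
    (hx : 2 * R ≤ |Real.log ‖x‖|) : hsV d R x = 0 := by
  apply hsF.zero_of_le_dist
  rw [dist_zero_right, Real.norm_eq_abs, abs_div, abs_of_pos hR, le_div_iff₀ hR]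
  exact hx

lemma hsV_zero' (d : ℕ) (R : ℝ) (hR : 0 < R) (x : EuclideanSpace ℝ (Fin d)) (h0 : x ≠ 0)
    (hx : x ∉ hsT d (-(2 * R)) (2 * R)) : hsV d R x = 0 := by
  apply hsV_zero d R hR
  by_contra h
  exact hx ⟨h0, abs_le.1 (le_of_not_ge h)⟩

lemma hsV_bound : ∃ L : ℝ, 0 ≤ L ∧ ∀ (d : ℕ) (R : ℝ), 0 < R → ∀ x y : EuclideanSpace ℝ (Fin d),
    x ≠ 0 → y ≠ 0 →
    (hsV d R x - hsV d R y) ^ 2 ≤ (L ^ 2 / R ^ 2) * ((‖x‖ - ‖y‖) ^ 2 / (‖x‖ * ‖y‖)) := by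
  obtain ⟨L, hL⟩ := ContDiff.lipschitzWith_of_hasCompactSupport (𝕂 := ℝ) (n := 1) (f := fun t => hsF t)
    hsF.hasCompactSupport hsF.contDiff (by simp)
  refine ⟨L, L.2, ?_⟩
  intro d R hR x y hx hy
  have h := hL.dist_le_mul (Real.log ‖x‖ / R) (Real.log ‖y‖ / R)
  rw [Real.dist_eq, Real.dist_eq] at h
  calc (hsV d R x - hsV d R y) ^ 2 = |hsV d R x - hsV d R y| ^ 2 := (sq_abs _).symm
    _ ≤ (L * |Real.log ‖x‖ / R - Real.log ‖y‖ / R|) ^ 2 := by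
        gcongr; exact h
    _ = (L ^ 2 / R ^ 2) * (Real.log ‖x‖ - Real.log ‖y‖) ^ 2 := by
        rw [mul_pow, sq_abs]; field_simp
    _ ≤ _ := by
        gcongr
        exact hs_log _ _ (norm_pos_iff.2 hx) (norm_pos_iff.2 hy)

lemma hs_smooth (d : ℕ) (R k e : ℝ) (hR : 0 < R) (he : e ≠ 0) :
    ContDiff ℝ (⊤ : ℕ∞) (fun x => hsV d R x * (k * ‖x‖ ^ e)) ∧
    HasCompactSupport (fun x => hsV d R x * (k * ‖x‖ ^ e)) ∧
    tsupport (fun x => hsV d R x * (k * ‖x‖ ^ e)) ⊆ {(0 : EuclideanSpace ℝ (Fin d))}ᶜ := by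
  have hz : (fun x : EuclideanSpace ℝ (Fin d) => hsV d R x * (k * ‖x‖ ^ e)) =ᶠ[nhds 0] 0 := by
    filter_upwards [Metric.ball_mem_nhds 0 (Real.exp_pos (-(2 * R)))] with x hx
    by_cases h0 : x = 0
    · simp [h0, Real.zero_rpow he]
    · rw [mem_ball_zero_iff] at hx
      have : Real.log ‖x‖ < -(2 * R) := (Real.log_lt_iff_lt_exp (norm_pos_iff.2 h0)).2 hx
      have hz := hsV_zero d R hR x (by rw [abs_of_neg (by linarith)]; linarith)
      simp [hz]
  refine ⟨?_, ?_, ?_⟩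
  · rw [contDiff_iff_contDiffAt]
    intro x
    by_cases h0 : x = 0
    · rw [h0]
      exact (contDiffAt_const (c := (0:ℝ))).congr_of_eventuallyEq hz
    · have hn : ContDiffAt ℝ (⊤ : ℕ∞) (fun x : EuclideanSpace ℝ (Fin d) => ‖x‖) x :=
        contDiffAt_norm ℝ h0
      have hn0 : ‖x‖ ≠ 0 := norm_ne_zero_iff.2 h0
      have h1 : ContDiffAt ℝ (⊤ : ℕ∞) (fun x : EuclideanSpace ℝ (Fin d) => Real.log ‖x‖ / R) x :=
        (hn.log hn0).div_const R
      have h2 : ContDiffAt ℝ (⊤ : ℕ∞) (hsV d R) x :=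
        (hsF.contDiff.contDiffAt (x := Real.log ‖x‖ / R)).comp x h1
      exact h2.mul (contDiffAt_const.mul (hn.rpow_const_of_ne hn0))
  · apply HasCompactSupport.intro (isCompact_closedBall (0 : EuclideanSpace ℝ (Fin d)) (Real.exp (2 * R)))
    intro x hx
    rw [mem_closedBall_zero_iff, not_le] at hx
    have hp : 0 < ‖x‖ := (Real.exp_pos _).trans hx
    have : 2 * R < Real.log ‖x‖ := (Real.lt_log_iff_exp_lt hp).2 hx
    have hz := hsV_zero d R hR x (by rw [abs_of_pos (by linarith)]; linarith)
    simp [hz]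
  · rw [Set.subset_compl_singleton_iff, notMem_tsupport_iff_eventuallyEq]
    exact hz

lemma hs_Hconst (d : ℕ) (hd : 2 ≤ d) (σ b : ℝ) (h0 : 0 < σ) (h1 : σ < 1) (hb : b = (d + 2 * σ) / 4) :
    fracLapConst d σ / 2 * (4 ^ ((d:ℝ)/2 - -σ) * Real.Gamma ((d:ℝ)/2 - -σ))⁻¹ *
      (2 * ((4 * Real.pi) ^ ((d:ℝ)/2) * (Real.Gamma (1 - σ) * Real.Gamma b / (σ * Real.Gamma (b - σ)) *
        ((4 ^ ((d:ℝ)/2 - (b + -σ)) * Real.Gamma ((d:ℝ)/2 - (b + -σ))) /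
          (4 ^ ((d:ℝ)/2 - b) * Real.Gamma ((d:ℝ)/2 - b)))))) = hardyConst d σ := by
  have hd' : (2:ℝ) ≤ d := by exact_mod_cast hd
  have g1 : Real.Gamma (2 - σ) = (1 - σ) * Real.Gamma (1 - σ) := by
    rw [← Real.Gamma_add_one (by linarith)]; congr 1; ring
  have e1 : (d:ℝ)/2 - (b + -σ) = b := by rw [hb]; ring
  have e2 : (d:ℝ)/2 - b = b - σ := by rw [hb]; ring
  have e3 : (d:ℝ)/4 + σ/2 = b := by rw [hb]; ring
  have e4 : (d:ℝ)/4 - σ/2 = b - σ := by rw [hb]; ring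
  have e5 : (d:ℝ)/2 - -σ = d/2 + σ := by ring
  have e6 : (2:ℝ) ^ (2 * σ) = 4 ^ σ := by
    rw [Real.rpow_mul (by norm_num)]; norm_num
  have e7 : (4:ℝ) ^ (b - σ) = 4 ^ b / 4 ^ σ := Real.rpow_sub (by norm_num) _ _
  have e8 : (4:ℝ) ^ ((d:ℝ)/2 + σ) = 4 ^ ((d:ℝ)/2) * 4 ^ σ := Real.rpow_add (by norm_num) _ _
  have e9 : Real.pi ^ (-(d:ℝ)/2) = (Real.pi ^ ((d:ℝ)/2))⁻¹ := by
    rw [neg_div, Real.rpow_neg Real.pi_pos.le]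
  have e10 : (4 * Real.pi) ^ ((d:ℝ)/2) = 4 ^ ((d:ℝ)/2) * Real.pi ^ ((d:ℝ)/2) :=
    Real.mul_rpow (by norm_num) Real.pi_pos.le
  unfold fracLapConst hardyConst
  rw [e1, e2, e3, e4, e5, e6, e7, e8, e9, e10, g1]
  have p1 : 0 < Real.Gamma (1 - σ) := Real.Gamma_pos_of_pos (by linarith)
  have p2 : 0 < Real.Gamma b := Real.Gamma_pos_of_pos (by rw [hb]; linarith)
  have p3 : 0 < Real.Gamma (b - σ) := Real.Gamma_pos_of_pos (by rw [hb]; linarith)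
  have p4 : 0 < Real.Gamma ((d:ℝ)/2 + σ) := Real.Gamma_pos_of_pos (by linarith)
  have p5 : 0 < (4:ℝ) ^ σ := Real.rpow_pos_of_pos (by norm_num) _
  have p6 : 0 < (4:ℝ) ^ b := Real.rpow_pos_of_pos (by norm_num) _
  have p7 : 0 < (4:ℝ) ^ ((d:ℝ)/2) := Real.rpow_pos_of_pos (by norm_num) _
  have p8 : 0 < Real.pi ^ ((d:ℝ)/2) := Real.rpow_pos_of_pos Real.pi_pos _
  have p9 : 0 < 1 - σ := by linarith
  generalize Real.Gamma (1 - σ) = x1 at *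
  generalize Real.Gamma (b - σ) = x3 at *
  generalize Real.Gamma ((d:ℝ)/2 + σ) = x4 at *
  generalize (4:ℝ) ^ ((d:ℝ)/2) = x7 at *
  generalize Real.pi ^ ((d:ℝ)/2) = x8 at *
  generalize (4:ℝ) ^ σ = x5 at *
  generalize (4:ℝ) ^ b = x6 at *
  generalize Real.Gamma b = x2 at *
  generalize 1 - σ = x9 at *
  field_simp

lemma hs_I_le (d : ℕ) (R k σ b : ℝ) (hd : 2 ≤ d) (hR : 0 < R)
    (hb : b = (d + 2 * σ) / 4) :
    ∫⁻ x : EuclideanSpace ℝ (Fin d),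
      ENNReal.ofReal ((hsV d R x * (k * ‖x‖ ^ (2 * b - d))) ^ 2 * ‖x‖ ^ (-(2 * σ))) =
    ENNReal.ofReal (k ^ 2) * ∫⁻ x in hsT d (-(2 * R)) (2 * R),
      ENNReal.ofReal (hsV d R x ^ 2) * ENNReal.ofReal (‖x‖ ^ (-(d:ℝ))) := by
  have : Nonempty (Fin d) := ⟨⟨0, by omega⟩⟩
  have ae0 : ∀ᵐ y : EuclideanSpace ℝ (Fin d), y ≠ 0 := by simp [ae_iff]
  rw [← lintegral_const_mul' _ _ ENNReal.ofReal_ne_top, ← lintegral_indicator (hsT_meas d _ _)]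
  refine lintegral_congr_ae ?_
  filter_upwards [ae0] with x hx
  have hx' := norm_pos_iff.2 hx
  by_cases hS : x ∈ hsT d (-(2 * R)) (2 * R)
  · rw [Set.indicator_of_mem hS, ← ENNReal.ofReal_mul (by positivity),
      ← ENNReal.ofReal_mul (by positivity)]
    congr 1
    have : ‖x‖ ^ (-(d:ℝ)) = ‖x‖ ^ (2 * b - d) * ‖x‖ ^ (2 * b - d) * ‖x‖ ^ (-(2 * σ)) := by
      rw [← Real.rpow_add hx', ← Real.rpow_add hx']; congr 1; rw [hb]; ring
    rw [this]; ring
  · rw [Set.indicator_of_notMem hS, hsV_zero' d R hR x hx hS]; simp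

lemma hs_I_lower (d : ℕ) (R : ℝ) (hR : 0 < R) :
    ∫⁻ x in hsT d (-R) R, ENNReal.ofReal (‖x‖ ^ (-(d:ℝ))) ≤
    ∫⁻ x in hsT d (-(2 * R)) (2 * R),
      ENNReal.ofReal (hsV d R x ^ 2) * ENNReal.ofReal (‖x‖ ^ (-(d:ℝ))) := by
  have hsub : hsT d (-R) R ⊆ hsT d (-(2 * R)) (2 * R) := by
    intro x hx; exact ⟨hx.1, by linarith [hx.2.1], by linarith [hx.2.2]⟩
  refine le_trans (le_of_eq ?_) (lintegral_mono_set hsub)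
  refine setLIntegral_congr_fun (hsT_meas d _ _) ?_
  intro x hx
  simp [hsV_one d R hR x hx]

lemma hs_I_fin (d : ℕ) (R e : ℝ) :
    ∫⁻ x in hsT d (-(2 * R)) (2 * R),
      ENNReal.ofReal (hsV d R x ^ 2) * ENNReal.ofReal (‖x‖ ^ e) ≠ ⊤ := by
  refine (lt_of_le_of_lt (lintegral_mono fun x => ?_) (hsT_fin d (-(2 * R)) (2 * R) e).lt_top).ne
  have h0 : 0 ≤ hsV d R x := hsF.nonneg
  have h1 : hsV d R x ≤ 1 := hsF.le_one
  have : ENNReal.ofReal (hsV d R x ^ 2) ≤ 1 := by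
    rw [ENNReal.ofReal_le_one]; nlinarith
  calc _ ≤ 1 * ENNReal.ofReal (‖x‖ ^ e) := by gcongr
    _ = _ := one_mul _

lemma hs_D (d : ℕ) (hd : 2 ≤ d) (σ : ℝ) (h0 : 0 < σ) (K : ℝ)
    (hK : K = 4 ^ ((d:ℝ)/2 - -σ) * Real.Gamma ((d:ℝ)/2 - -σ)) (Kpos : 0 < K)
    (ζ : EuclideanSpace ℝ (Fin d) → ℝ) :
    ∫⁻ x : EuclideanSpace ℝ (Fin d), ∫⁻ y : EuclideanSpace ℝ (Fin d),
      ENNReal.ofReal ((ζ x - ζ y) ^ 2 * ‖x - y‖ ^ (-(d : ℝ) - 2 * σ)) =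
    ENNReal.ofReal K⁻¹ * ∫⁻ x : EuclideanSpace ℝ (Fin d), ∫⁻ y : EuclideanSpace ℝ (Fin d),
      ENNReal.ofReal ((ζ x - ζ y) ^ 2) * hsR (-σ) (x - y) := by
  have hd' : (2:ℝ) ≤ d := by exact_mod_cast hd
  rw [← lintegral_const_mul' _ _ ENNReal.ofReal_ne_top]
  refine lintegral_congr fun x => ?_
  rw [← lintegral_const_mul' _ _ ENNReal.ofReal_ne_top]
  refine lintegral_congr fun y => ?_
  by_cases hxy : x = y
  · subst hxy; simp
  · rw [hsR_eq (-σ) (by linarith) _ (sub_ne_zero.2 hxy), ← hK,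
      ← ENNReal.ofReal_mul (by positivity), ← ENNReal.ofReal_mul (by positivity)]
    congr 1
    rw [show -(d:ℝ) - 2 * σ = 2 * -σ - d by ring]
    field_simp

lemma hs_J (d : ℕ) (hd : 2 ≤ d) (σ b k K : ℝ) (h0 : 0 < σ) (h1 : σ < 1) (hb : b = (d + 2 * σ) / 4)
    (hK : K = 4 ^ ((d:ℝ)/2 - (b + -σ)) * Real.Gamma ((d:ℝ)/2 - (b + -σ))) (Kpos : 0 < K)
    (kpos : 0 < k) (v : EuclideanSpace ℝ (Fin d) → ℝ) :
    ∫⁻ x : EuclideanSpace ℝ (Fin d), ENNReal.ofReal (v x ^ 2 * (k * ‖x‖ ^ (2 * b - d))) *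
      hsR (b + -σ) x = ENNReal.ofReal (K / k) * ∫⁻ x : EuclideanSpace ℝ (Fin d),
      ENNReal.ofReal ((v x * (k * ‖x‖ ^ (2 * b - d))) ^ 2 * ‖x‖ ^ (-(2 * σ))) := by
  have hd' : (2:ℝ) ≤ d := by exact_mod_cast hd
  have : Nonempty (Fin d) := ⟨⟨0, by omega⟩⟩
  have ae0 : ∀ᵐ y : EuclideanSpace ℝ (Fin d), y ≠ 0 := by simp [ae_iff]
  rw [← lintegral_const_mul' _ _ ENNReal.ofReal_ne_top]
  refine lintegral_congr_ae ?_
  filter_upwards [ae0] with x hx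
  have hx' := norm_pos_iff.2 hx
  rw [hsR_eq (b + -σ) (by rw [hb]; linarith) _ hx, ← hK,
      ← ENNReal.ofReal_mul (by positivity), ← ENNReal.ofReal_mul (by positivity)]
  congr 1
  have : ‖x‖ ^ (2 * (b + -σ) - d) = ‖x‖ ^ (2 * b - d) * ‖x‖ ^ (-(2 * σ)) := by
    rw [← Real.rpow_add hx']; congr 1; ring
  rw [this]
  field_simp

lemma hs_fin2 (d : ℕ) (hd : 2 ≤ d) (R k b : ℝ) (hR : 0 < R) (hk : 0 ≤ k) :
    ∫⁻ x : EuclideanSpace ℝ (Fin d), ENNReal.ofReal (hsV d R x ^ 2 * (k * ‖x‖ ^ (2 * b - d))) *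
      ENNReal.ofReal (k * ‖x‖ ^ (2 * b - d)) ≠ ⊤ := by
  have : Nonempty (Fin d) := ⟨⟨0, by omega⟩⟩
  have ae0 : ∀ᵐ y : EuclideanSpace ℝ (Fin d), y ≠ 0 := by simp [ae_iff]
  have : ∫⁻ x : EuclideanSpace ℝ (Fin d), ENNReal.ofReal (hsV d R x ^ 2 * (k * ‖x‖ ^ (2 * b - d))) *
      ENNReal.ofReal (k * ‖x‖ ^ (2 * b - d)) = ENNReal.ofReal (k ^ 2) *
      ∫⁻ x in hsT d (-(2 * R)) (2 * R),
      ENNReal.ofReal (hsV d R x ^ 2) * ENNReal.ofReal (‖x‖ ^ ((2 * b - d) + (2 * b - d))) := by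
    rw [← lintegral_const_mul' _ _ ENNReal.ofReal_ne_top, ← lintegral_indicator (hsT_meas d _ _)]
    refine lintegral_congr_ae ?_
    filter_upwards [ae0] with x hx
    have hx' := norm_pos_iff.2 hx
    by_cases hS : x ∈ hsT d (-(2 * R)) (2 * R)
    · rw [Set.indicator_of_mem hS, ← ENNReal.ofReal_mul (by positivity),
        ← ENNReal.ofReal_mul (by positivity), ← ENNReal.ofReal_mul (by positivity)]
      congr 1
      rw [Real.rpow_add hx']; ring
    · rw [Set.indicator_of_notMem hS, hsV_zero' d R hR x hx hS]; simp
  rw [this]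
  exact ENNReal.mul_ne_top ENNReal.ofReal_ne_top (hs_I_fin d R _)

lemma hs_final (c' N G q m H ε : ℝ) (I X E : ℝ≥0∞) (hc : 0 ≤ c') (hN : 0 ≤ N) (hG : 0 ≤ G)
    (hq : 0 ≤ q) (hH0 : 0 ≤ H) (hε : 0 ≤ ε)
    (hE : E = 2 * (ENNReal.ofReal N * (ENNReal.ofReal G * (ENNReal.ofReal q * I))) + X)
    (hX : X ≤ ENNReal.ofReal m * I)
    (hH : c' * (2 * (N * (G * q))) = H) (hm : c' * m ≤ ε) :
    ENNReal.ofReal c' * E ≤ ENNReal.ofReal (H + ε) * I := by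
  have e : ENNReal.ofReal c' * (2 * (ENNReal.ofReal N * (ENNReal.ofReal G * (ENNReal.ofReal q * I)))) =
      ENNReal.ofReal H * I := by
    rw [← hH, ENNReal.ofReal_mul hc, ENNReal.ofReal_mul (by norm_num), ENNReal.ofReal_mul hN,
      ENNReal.ofReal_mul hG, ENNReal.ofReal_ofNat]
    ring
  rw [hE, mul_add, e, ENNReal.ofReal_add hH0 hε, add_mul]
  refine add_le_add le_rfl ?_
  calc _ ≤ ENNReal.ofReal c' * (ENNReal.ofReal m * I) := by gcongr
    _ = ENNReal.ofReal (c' * m) * I := by rw [ENNReal.ofReal_mul hc, mul_assoc]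
    _ ≤ _ := by gcongr

/-- almost saturation of the fractional Hardy–Rellich inequality by radial
smooth functions compactly supported away from the origin: for every `d ≥ 2`, `σ ∈ (0,1)`
and `ε > 0` there is a nontrivial radial `ζ ∈ C_c^∞(ℝ^d \ {0})` with
`(c_{d,σ}/2) ∬ |ζ(x)−ζ(y)|²|x−y|^{−d−2σ} ≤ (H_{d,σ}+ε) ∫ ζ² |x|^{−2σ}`. -/
theorem hardy_almost_saturation (d : ℕ) (hd : 2 ≤ d) (σ : ℝ)
    (hσ : σ ∈ Set.Ioo (0 : ℝ) 1) (ε : ℝ) (hε : 0 < ε) :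
    ∃ ζ : EuclideanSpace ℝ (Fin d) → ℝ,
      ContDiff ℝ (⊤ : ℕ∞) ζ ∧ HasCompactSupport ζ ∧
      tsupport ζ ⊆ {(0 : EuclideanSpace ℝ (Fin d))}ᶜ ∧
      (∃ g : ℝ → ℝ, ∀ x, ζ x = g ‖x‖) ∧
      ζ ≠ 0 ∧
      ENNReal.ofReal (fracLapConst d σ / 2) *
          (∫⁻ x : EuclideanSpace ℝ (Fin d), ∫⁻ y : EuclideanSpace ℝ (Fin d),
            ENNReal.ofReal ((ζ x - ζ y) ^ 2 * ‖x - y‖ ^ (-(d : ℝ) - 2 * σ)))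
        ≤ ENNReal.ofReal (hardyConst d σ + ε) *
          ∫⁻ x : EuclideanSpace ℝ (Fin d),
            ENNReal.ofReal (ζ x ^ 2 * ‖x‖ ^ (-(2 * σ))) := by
  obtain ⟨h0, h1⟩ := hσ
  have hd' : (2:ℝ) ≤ d := by exact_mod_cast hd
  obtain ⟨b, hb⟩ : ∃ b : ℝ, b = (d + 2 * σ) / 4 := ⟨_, rfl⟩
  obtain ⟨A, hA, hrem⟩ := hs_rem2 hd σ b h0 h1 hb
  obtain ⟨L, hL, hV⟩ := hsV_bound
  obtain ⟨K1, hK1⟩ : ∃ K : ℝ, K = 4 ^ ((d:ℝ)/2 - -σ) * Real.Gamma ((d:ℝ)/2 - -σ) := ⟨_, rfl⟩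
  obtain ⟨K2, hK2⟩ : ∃ K : ℝ, K = 4 ^ ((d:ℝ)/2 - (b + -σ)) * Real.Gamma ((d:ℝ)/2 - (b + -σ)) :=
    ⟨_, rfl⟩
  obtain ⟨k, hk⟩ : ∃ K : ℝ, K = 4 ^ ((d:ℝ)/2 - b) * Real.Gamma ((d:ℝ)/2 - b) := ⟨_, rfl⟩
  have K1pos : 0 < K1 := by
    rw [hK1]
    exact mul_pos (Real.rpow_pos_of_pos (by norm_num) _) (Real.Gamma_pos_of_pos (by linarith))
  have K2pos : 0 < K2 := by
    rw [hK2]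
    exact mul_pos (Real.rpow_pos_of_pos (by norm_num) _)
      (Real.Gamma_pos_of_pos (by rw [hb]; linarith))
  have kpos : 0 < k := by
    rw [hk]
    exact mul_pos (Real.rpow_pos_of_pos (by norm_num) _)
      (Real.Gamma_pos_of_pos (by rw [hb]; linarith))
  have cpos : 0 < fracLapConst d σ := by
    unfold fracLapConst
    have p1 : 0 < Real.Gamma ((d:ℝ)/2 + σ) := Real.Gamma_pos_of_pos (by linarith)
    have p2 : 0 < Real.Gamma (2 - σ) := Real.Gamma_pos_of_pos (by linarith)
    have p3 : 0 < 1 - σ := by linarith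
    have := Real.pi_pos
    positivity
  have hHc := hs_Hconst d hd σ b h0 h1 hb
  rw [← hK1, ← hK2, ← hk] at hHc
  set c' := fracLapConst d σ / 2 * K1⁻¹ with hc'
  have c'pos : 0 < c' := by positivity
  set C := c' * (2 * L ^ 2 * A) with hC
  have hC0 : 0 ≤ C := by positivity
  obtain ⟨R, hRdef⟩ : ∃ R : ℝ, R = 1 + C / ε := ⟨_, rfl⟩
  have hR1 : 1 ≤ R := by
    have : 0 ≤ C / ε := by positivity
    linarith
  have hR : 0 < R := by linarith
  have hCR : C ≤ ε * R ^ 2 := by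
    have h2 : ε * R = ε + C := by rw [hRdef]; field_simp
    nlinarith [mul_nonneg hε.le (mul_nonneg hR.le (sub_nonneg.2 hR1))]
  have he : 2 * b - (d:ℝ) ≠ 0 := by
    rw [hb]; intro h; linarith
  obtain ⟨s1, s2, s3⟩ := hs_smooth d R k (2 * b - d) hR he
  refine ⟨fun x => hsV d R x * (k * ‖x‖ ^ (2 * b - d)), s1, s2, s3, ?_, ?_, ?_⟩
  · exact ⟨fun t => hsF (Real.log t / R) * (k * t ^ (2 * b - d)), fun x => rfl⟩
  · intro h
    have hn : ‖EuclideanSpace.single (⟨0, by omega⟩ : Fin d) (1:ℝ)‖ = 1 := by simp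
    have hz := congrFun h (EuclideanSpace.single (⟨0, by omega⟩ : Fin d) (1:ℝ))
    have hm : EuclideanSpace.single (⟨0, by omega⟩ : Fin d) (1:ℝ) ∈ hsT d (-R) R := by
      refine ⟨?_, ?_, ?_⟩
      · intro h'; rw [h'] at hn; simp at hn
      · rw [hn]; simp [hR.le]
      · rw [hn]; simp [hR.le]
    simp only [hsV_one d R hR _ hm, hn, Real.one_rpow, mul_one, one_mul, Pi.zero_apply] at hz
    exact kpos.ne' hz
  · have hI := hs_I_le d R k σ b hd hR hb
    have hJ := hs_J d hd σ b k K2 h0 h1 hb hK2 K2pos kpos (hsV d R)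
    have hD := hs_D d hd σ h0 K1 hK1 K1pos (fun x => hsV d R x * (k * ‖x‖ ^ (2 * b - d)))
    have hIlow := hs_I_lower d R hR
    have hIfin := hs_I_fin d R (-(d:ℝ))
    have hrem' := hrem (hsV d R) (hsT d (-(2 * R)) (2 * R)) k (L ^ 2 / R ^ 2) (hsT_meas d _ _) kpos.le
      (by positivity) (hV d R hR) (fun x hx hS => hsV_zero' d R hR x hx hS)
    have hfin1 := hs_fin2 d hd R k b hR kpos.le
    have hIne : ∫⁻ x : EuclideanSpace ℝ (Fin d),
        ENNReal.ofReal ((hsV d R x * (k * ‖x‖ ^ (2 * b - d))) ^ 2 * ‖x‖ ^ (-(2 * σ))) ≠ ⊤ := by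
      rw [hI]; exact ENNReal.mul_ne_top ENNReal.ofReal_ne_top hIfin
    have hfinJ : ∫⁻ x : EuclideanSpace ℝ (Fin d),
        ENNReal.ofReal (hsV d R x ^ 2 * (k * ‖x‖ ^ (2 * b - d))) * hsR (b + -σ) x ≠ ⊤ := by
      rw [hJ]; exact ENNReal.mul_ne_top ENNReal.ofReal_ne_top hIne
    have hg := hs_ground hd σ b h0 h1 (by rw [hb]; linarith) (hsV d R)
      (fun x => k * ‖x‖ ^ (2 * b - d)) (hsV_meas d R) (by fun_prop) (fun x => by positivity)
      (fun x hx => by rw [hsR_eq b (by rw [hb]; linarith) x hx, hk]) hfin1 hfinJ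
    rw [hJ] at hg
    rw [hD, ← mul_assoc, ← ENNReal.ofReal_mul (by positivity)]
    have g1 : 0 < Real.Gamma (1 - σ) := Real.Gamma_pos_of_pos (by linarith)
    have g2 : 0 < Real.Gamma b := Real.Gamma_pos_of_pos (by rw [hb]; linarith)
    have g3 : 0 < Real.Gamma (b - σ) := Real.Gamma_pos_of_pos (by rw [hb]; linarith)
    have hH0 : 0 ≤ hardyConst d σ := by unfold hardyConst; positivity
    refine hs_final c' _ _ _ (2 * (L ^ 2 / R ^ 2) * A) _ ε _ _ _ c'pos.le ?_ ?_ ?_ hH0 hε.le hg ?_ hHc ?_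
    · have := Real.pi_pos
      positivity
    · positivity
    · positivity
    · refine hrem'.trans ?_
      rw [hI]
      calc _ ≤ ENNReal.ofReal (k ^ 2 * (L ^ 2 / R ^ 2) * A) * (2 *
            ∫⁻ x in hsT d (-(2 * R)) (2 * R),
              ENNReal.ofReal (hsV d R x ^ 2) * ENNReal.ofReal (‖x‖ ^ (-(d:ℝ)))) :=
            mul_le_mul_right ((hsT_double d R).trans (mul_le_mul_right hIlow _)) _
        _ = _ := by
          rw [show k ^ 2 * (L ^ 2 / R ^ 2) * A = k ^ 2 * ((L ^ 2 / R ^ 2) * A) by ring,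
            mul_assoc 2, ENNReal.ofReal_mul (p := k ^ 2) (by positivity),
            ENNReal.ofReal_mul (p := 2) (by norm_num), ENNReal.ofReal_ofNat]
          ring
    · have : c' * (2 * (L ^ 2 / R ^ 2) * A) = C / R ^ 2 := by rw [hC]; ring
      rw [this, div_le_iff₀ (by positivity)]
      exact hCR
end
end

section
/- Let σ ∈ (0,1) and let g : (0,∞) → ℝ be measurable. Then, as an identity in [0,∞], ∬_{{(x,y) ∈ ℝ²×ℝ² : 0 < |x| ≤ |y|}} |g(|x|)−g(|y|)|² |x−y|^{−2−2σ} dx dy = ∫_0^∞ dr r^{1−2σ} ∫_1^∞ dτ τ |g(r)−g(rτ)|² (∬_{S¹×S¹} |X̂ − τŶ|^{−2−2σ} dH¹(X̂) dH¹(Ŷ)). -/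
open MeasureTheory
open scoped ENNReal

noncomputable section

abbrev E2 := EuclideanSpace ℝ (Fin 2)


/-- unit circle parametrization -/
def circ (θ : ℝ) : E2 := !₂[Real.cos θ, Real.sin θ]

lemma circ_continuous : Continuous circ := by
  unfold circ; fun_prop

lemma dist_circ_sq (a b : ℝ) : dist (circ a) (circ b) ^ 2 = (2 * Real.sin ((a - b) / 2)) ^ 2 := by
  rw [EuclideanSpace.dist_eq, Real.sq_sqrt (by positivity)]
  simp only [Fin.sum_univ_two, Real.dist_eq, sq_abs, circ]
  simp
  have h1 : Real.cos (a - b) = 1 - 2 * Real.sin ((a - b) / 2) ^ 2 := by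
    rw [← Real.cos_sq_add_sin_sq ((a-b)/2)]
    have : a - b = 2 * ((a - b) / 2) := by ring
    conv_lhs => rw [this, Real.cos_two_mul']
    ring
  rw [Real.cos_sub] at h1
  nlinarith [Real.cos_sq_add_sin_sq a, Real.cos_sq_add_sin_sq b]

lemma dist_circ (a b : ℝ) : dist (circ a) (circ b) = 2 * |Real.sin ((a - b) / 2)| := by
  have := dist_circ_sq a b
  rw [← abs_of_nonneg (dist_nonneg (x := circ a) (y := circ b)), (sq_eq_sq_iff_abs_eq_abs _ _).1 this,
    abs_mul]
  norm_num

lemma circ_lip : LipschitzWith 1 circ := by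
  apply LipschitzWith.of_dist_le_mul
  intro a b
  rw [dist_circ, Real.dist_eq]
  have := Real.abs_sin_le_abs (x := (a-b)/2)
  rw [abs_div] at this
  norm_num at this ⊢
  linarith

lemma circ_anti {δ : ℝ} (h0 : 0 < δ) (h1 : δ ≤ 1) {a b : ℝ} (h : |a - b| ≤ δ) :
    dist a b ≤ (1 + δ) * dist (circ a) (circ b) := by
  wlog hab : b ≤ a generalizing a b
  · rw [dist_comm, dist_comm (circ a)]
    exact this (by rwa [abs_sub_comm]) (by linarith)
  rcases hab.eq_or_lt with rfl | hab
  · simp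
  rw [dist_circ, Real.dist_eq]
  have h2 : 0 < a - b := by linarith
  rw [abs_of_pos h2] at *
  have h3 := Real.sin_gt_sub_cube (x := (a-b)/2) (by linarith)
  set t := a - b
  have h4 : t * (1 - δ^2/16) ≤ 2 * |Real.sin (t/2)| := by
    have := le_abs_self (Real.sin (t/2))
    have : t ^ 3 ≤ t * δ ^ 2 := by
      have : t^2 ≤ δ^2 := by gcongr
      nlinarith
    have : 0 ≤ t ^ 3 := by positivity
    linarith
  calc t ≤ (1 + δ) * (t * (1 - δ^2/16)) := by
        have : 1 ≤ (1+δ) * (1 - δ^2/16) := by nlinarith [mul_nonneg h0.le h0.le]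
        nlinarith
    _ ≤ _ := by gcongr

def argE (x : E2) : ℝ := Complex.arg ⟨x 0, x 1⟩

lemma argE_circ {θ : ℝ} (h : θ ∈ Set.Ioc (-Real.pi) Real.pi) : argE (circ θ) = θ := by
  have := Complex.arg_cos_add_sin_mul_I h
  rw [← this]
  unfold argE circ
  rw [this, ← this]
  congr 1
  apply Complex.ext <;> simp [Complex.cos_ofReal_re, Complex.sin_ofReal_re, this]

lemma circ_argE {x : E2} (h : x ∈ Metric.sphere (0:E2) 1) : circ (argE x) = x := by
  have hx : ‖(⟨x 0, x 1⟩ : ℂ)‖ = 1 := by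
    rw [mem_sphere_zero_iff_norm, EuclideanSpace.norm_eq] at h
    rw [Complex.norm_def, Complex.normSq_apply]
    simpa [Fin.sum_univ_two, sq] using h
  have hne : (⟨x 0, x 1⟩ : ℂ) ≠ 0 := by
    intro h; rw [h] at hx; simp at hx
  ext i
  fin_cases i
  · simp [circ, argE, Complex.cos_arg hne, hx]
  · simp [circ, argE, Complex.sin_arg, hx]

lemma circ_mem (θ : ℝ) : circ θ ∈ Metric.sphere (0:E2) 1 := by
  rw [mem_sphere_zero_iff_norm, EuclideanSpace.norm_eq]
  simp [circ]

lemma circ_injOn : Set.InjOn circ (Set.Ioc (-Real.pi) Real.pi) := by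
  intro a ha b hb h
  rw [← argE_circ ha, h, argE_circ hb]

lemma vol_le {A : Set ℝ} (hA : MeasurableSet A) (hs : A ⊆ Set.Ioc (-Real.pi) Real.pi)
    {δ : ℝ} (h0 : 0 < δ) (h1 : δ ≤ 1) :
    volume A ≤ ENNReal.ofReal (1 + δ) * μH[1] (circ '' A) := by
  let I : ℤ → Set ℝ := fun n => Set.Ioc (0 + n • δ) (0 + (n + 1) • δ)
  have hI : ⋃ n, I n = Set.univ := iUnion_Ioc_add_zsmul h0 0
  have hd : Pairwise (Function.onFun Disjoint I) := Set.pairwise_disjoint_Ioc_add_zsmul 0 δ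
  have hu : A = ⋃ n, A ∩ I n := by rw [← Set.inter_iUnion, hI, Set.inter_univ]
  have hm : ∀ n, MeasurableSet (A ∩ I n) := fun n => hA.inter measurableSet_Ioc
  have hpiece : ∀ n, volume (A ∩ I n) ≤ ENNReal.ofReal (1 + δ) * μH[1] (circ '' (A ∩ I n)) := by
    intro n
    have hl : LipschitzOnWith (Real.toNNReal (1 + δ)) argE (circ '' (A ∩ I n)) := by
      apply LipschitzOnWith.of_dist_le_mul
      rintro _ ⟨a, ha, rfl⟩ _ ⟨b, hb, rfl⟩
      rw [argE_circ (hs ha.1), argE_circ (hs hb.1), Real.coe_toNNReal _ (by linarith)]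
      apply circ_anti h0 h1
      have h2 := ha.2
      have h3 := hb.2
      simp only [I, Set.mem_Ioc, add_smul, one_smul] at h2 h3
      rw [abs_le]; constructor <;> linarith [h2.1, h2.2, h3.1, h3.2]
    have := hl.hausdorffMeasure_image_le (d := 1) zero_le_one
    have him : (fun x => argE (circ x)) '' (A ∩ I n) = A ∩ I n := by
      rw [Set.image_congr (f := fun x => argE (circ x)) (g := fun x => x)
        (fun a (ha : a ∈ A ∩ I n) => argE_circ (hs ha.1)), Set.image_id']
    rw [Set.image_image, him, hausdorffMeasure_real, ENNReal.rpow_one] at this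
    exact this
  calc volume A = ∑' n, volume (A ∩ I n) := by
        conv_lhs => rw [hu]
        exact measure_iUnion (fun i j hij => (hd hij).mono Set.inter_subset_right Set.inter_subset_right) hm
    _ ≤ ∑' n, ENNReal.ofReal (1 + δ) * μH[1] (circ '' (A ∩ I n)) := ENNReal.tsum_le_tsum hpiece
    _ = ENNReal.ofReal (1 + δ) * μH[1] (circ '' A) := by
        rw [ENNReal.tsum_mul_left]
        congr 1
        conv_rhs => rw [hu, Set.image_iUnion]
        refine (measure_iUnion ?_ ?_).symm
        · intro i j hij
          refine Set.disjoint_image_image fun a ha b hb hab => ?_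
          have := circ_injOn (hs ha.1) (hs hb.1) hab
          subst this
          exact Set.disjoint_left.1 (hd hij) ha.2 hb.2
        · intro n
          exact (hm n).image_of_continuousOn_injOn circ_continuous.continuousOn
            (circ_injOn.mono (Set.inter_subset_left.trans hs))

lemma haus_image {A : Set ℝ} (hA : MeasurableSet A) (hs : A ⊆ Set.Ioc (-Real.pi) Real.pi) :
    μH[1] (circ '' A) = volume A := by
  have hle : μH[1] (circ '' A) ≤ volume A := by
    have := circ_lip.hausdorffMeasure_image_le (d := 1) zero_le_one A
    simpa [hausdorffMeasure_real] using this
  apply le_antisymm hle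
  have hfin : μH[1] (circ '' A) ≠ ∞ := by
    refine ne_top_of_le_ne_top ?_ (hle.trans (measure_mono hs))
    simp
  have ht : Filter.Tendsto (fun δ : ℝ => ENNReal.ofReal (1 + δ) * μH[1] (circ '' A))
      (nhdsWithin 0 (Set.Ioi 0)) (nhds (1 * μH[1] (circ '' A))) := by
    apply ENNReal.Tendsto.mul_const _ (Or.inr hfin)
    have : Continuous (fun δ : ℝ => ENNReal.ofReal (1 + δ)) :=
      ENNReal.continuous_ofReal.comp (by fun_prop)
    have := (this.tendsto 0).mono_left (nhdsWithin_le_nhds (s := Set.Ioi 0))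
    simpa using this
  rw [one_mul] at ht
  refine ge_of_tendsto ht ?_
  filter_upwards [Ioc_mem_nhdsGT (zero_lt_one' ℝ)] with δ hδ
  exact vol_le hA hs hδ.1 hδ.2

lemma haus_eq : (μH[1] : Measure E2).restrict (Metric.sphere 0 1) =
    (volume.restrict (Set.Ioc (-Real.pi) Real.pi)).map circ := by
  ext s hs
  have hc := circ_continuous.measurable
  rw [Measure.restrict_apply hs, Measure.map_apply hc hs, Measure.restrict_apply (hc hs),
    ← haus_image ((hc hs).inter measurableSet_Ioc) Set.inter_subset_right]
  congr 1
  ext x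
  constructor
  · rintro ⟨h1, h2⟩
    refine ⟨argE x, ⟨?_, Complex.arg_mem_Ioc _⟩, circ_argE h2⟩
    rwa [Set.mem_preimage, circ_argE h2]
  · rintro ⟨a, ⟨h1, h2⟩, rfl⟩
    exact ⟨h1, circ_mem a⟩

lemma lintegral_polar {f : E2 → ℝ≥0∞} (hf : Measurable f) :
    ∫⁻ x, f x = ∫⁻ r in Set.Ioi (0:ℝ), ENNReal.ofReal r *
      ∫⁻ X in Metric.sphere (0:E2) 1, f (r • X) ∂μH[1] := by
  have e1 : ∫⁻ x, f x = ∫⁻ p : ℝ × ℝ, f (!₂[p.1, p.2]) := by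
    rw [← (PiLp.volume_preserving_toLp (Fin 2)).lintegral_comp hf,
      ← ((volume_preserving_finTwoArrow ℝ).symm _).lintegral_comp (by fun_prop)]
    rfl
  rw [e1, ← lintegral_comp_polarCoord_symm, haus_eq]
  have : polarCoord.target = Set.Ioi (0:ℝ) ×ˢ Set.Ioo (-Real.pi) Real.pi := rfl
  rw [this, Measure.volume_eq_prod, ← Measure.prod_restrict, lintegral_prod]
  · refine lintegral_congr fun r => ?_
    rw [lintegral_map (by fun_prop) circ_continuous.measurable,
      Measure.restrict_congr_set Ioo_ae_eq_Ioc, ← lintegral_const_mul' _ _ (by simp)]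
    refine lintegral_congr fun θ => ?_
    simp only [smul_eq_mul, polarCoord_symm_apply]
    congr 2
    ext i; fin_cases i <;> simp [circ]
  · apply Measurable.aemeasurable
    have := continuous_polarCoord_symm.measurable
    fun_prop


lemma lintegral_scale (k : ℝ → ℝ≥0∞) {r : ℝ} (hr : 0 < r) :
    ∫⁻ t in Set.Ioi r, k t = ∫⁻ τ in Set.Ioi (1:ℝ), ENNReal.ofReal r * k (r * τ) := by
  have := lintegral_image_eq_lintegral_abs_deriv_mul (s := Set.Ioi (1:ℝ)) (f := fun τ => r * τ)
    (f' := fun _ => r) measurableSet_Ioi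
    (fun x _ => by simpa using ((hasDerivAt_id x).const_mul r).hasDerivWithinAt)
    (fun a _ b _ h => mul_left_cancel₀ hr.ne' h) k
  rw [Set.image_mul_left_Ioi hr, mul_one, abs_of_pos hr] at this
  exact this

instance sfin : SFinite ((μH[1] : Measure E2).restrict (Metric.sphere 0 1)) := by
  rw [haus_eq]; infer_instance

/-- polar-coordinates decomposition of the Gagliardo energy of a radial
function in `ℝ²`, restricted to the region `{0 < |x| ≤ |y|}`, as an identity in `[0,∞]`. -/
theorem gagliardo_polar_decomposition (σ : ℝ) (hσ : σ ∈ Set.Ioo (0 : ℝ) 1)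
    (g : ℝ → ℝ) (hg : Measurable g) :
    (∫⁻ p in {p : E2 × E2 | 0 < ‖p.1‖ ∧ ‖p.1‖ ≤ ‖p.2‖},
        ENNReal.ofReal ((g ‖p.1‖ - g ‖p.2‖) ^ 2 * ‖p.1 - p.2‖ ^ (-(2:ℝ) - 2 * σ)))
      = ∫⁻ r in Set.Ioi (0:ℝ), ∫⁻ τ in Set.Ioi (1:ℝ),
          ENNReal.ofReal (r ^ (1 - 2 * σ) * τ * (g r - g (r * τ)) ^ 2) *
            ∫⁻ X in Metric.sphere (0:E2) 1, ∫⁻ Y in Metric.sphere (0:E2) 1,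
              ENNReal.ofReal (‖X - τ • Y‖ ^ (-(2:ℝ) - 2 * σ)) ∂μH[1] ∂μH[1] := by
  set S : Set (E2 × E2) := {p : E2 × E2 | 0 < ‖p.1‖ ∧ ‖p.1‖ ≤ ‖p.2‖} with hS
  have hSm : MeasurableSet S := by
    have m1 : MeasurableSet {p : E2 × E2 | 0 < ‖p.1‖} :=
      measurableSet_lt (by fun_prop) (by fun_prop)
    have m2 : MeasurableSet {p : E2 × E2 | ‖p.1‖ ≤ ‖p.2‖} :=
      measurableSet_le (by fun_prop) (by fun_prop)
    exact m1.inter m2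
  set G : E2 × E2 → ℝ≥0∞ := fun p =>
    ENNReal.ofReal ((g ‖p.1‖ - g ‖p.2‖) ^ 2 * ‖p.1 - p.2‖ ^ (-(2:ℝ) - 2 * σ)) with hG
  have hGm : Measurable G := by fun_prop
  have hHm : Measurable (S.indicator G) := hGm.indicator hSm
  rw [← lintegral_indicator hSm, Measure.volume_eq_prod, lintegral_prod _ hHm.aemeasurable,
    lintegral_polar hHm.lintegral_prod_right']
  refine setLIntegral_congr_fun measurableSet_Ioi fun r (hr : 0 < r) => ?_
  have key : ∀ X ∈ Metric.sphere (0:E2) 1, ∫⁻ y, S.indicator G (r • X, y) =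
      ∫⁻ τ in Set.Ioi (1:ℝ), ENNReal.ofReal (r ^ (-(2 * σ)) * τ * (g r - g (r * τ)) ^ 2) *
        ∫⁻ Y in Metric.sphere (0:E2) 1,
              ENNReal.ofReal (‖X - τ • Y‖ ^ (-(2:ℝ) - 2 * σ)) ∂μH[1] := by
    intro X hX
    rw [mem_sphere_zero_iff_norm] at hX
    rw [lintegral_polar (f := fun y => S.indicator G (r • X, y)) (hHm.comp (by fun_prop))]
    let k : ℝ → ℝ≥0∞ := fun t => ENNReal.ofReal t * ∫⁻ Y in Metric.sphere (0:E2) 1,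
      ENNReal.ofReal ((g r - g t) ^ 2 * ‖r • X - t • Y‖ ^ (-(2:ℝ) - 2 * σ)) ∂μH[1]
    have h1 : ∫⁻ t in Set.Ioi (0:ℝ), ENNReal.ofReal t * ∫⁻ Y in Metric.sphere (0:E2) 1,
        S.indicator G (r • X, t • Y) ∂μH[1] = ∫⁻ t in Set.Ioi (0:ℝ), (Set.Ici r).indicator k t := by
      refine setLIntegral_congr_fun measurableSet_Ioi fun t (ht : 0 < t) => ?_
      have h2 : ∀ Y ∈ Metric.sphere (0:E2) 1, S.indicator G (r • X, t • Y) =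
          (Set.Ici r).indicator (fun t => ENNReal.ofReal ((g r - g t) ^ 2 *
            ‖r • X - t • Y‖ ^ (-(2:ℝ) - 2 * σ))) t := by
        intro Y hY
        rw [mem_sphere_zero_iff_norm] at hY
        have n1 : ‖r • X‖ = r := by rw [norm_smul, hX, Real.norm_of_nonneg hr.le, mul_one]
        have n2 : ‖t • Y‖ = t := by rw [norm_smul, hY, Real.norm_of_nonneg ht.le, mul_one]
        by_cases h : r ≤ t
        · rw [Set.indicator_of_mem (by
            rw [hS, Set.mem_setOf_eq, n1, n2]; exact ⟨hr, h⟩), Set.indicator_of_mem (by exact h)]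
          simp only [hG, n1, n2]
        · rw [Set.indicator_of_notMem (by simp [hS, n1, n2, h]),
            Set.indicator_of_notMem (by exact h)]
      beta_reduce
      rw [setLIntegral_congr_fun Metric.isClosed_sphere.measurableSet h2]
      by_cases h : r ≤ t
      · simp only [Set.indicator_of_mem (show t ∈ Set.Ici r from h), k]
      · simp only [Set.indicator_of_notMem (show t ∉ Set.Ici r from h)]
        simp
    rw [h1, lintegral_indicator measurableSet_Ici, Measure.restrict_restrict measurableSet_Ici,
      (Set.inter_eq_left.2 (fun t ht => lt_of_lt_of_le hr ht) : Set.Ici r ∩ Set.Ioi 0 = Set.Ici r),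
      ← Measure.restrict_congr_set Ioi_ae_eq_Ici, lintegral_scale k hr]
    refine setLIntegral_congr_fun measurableSet_Ioi fun τ (hτ : 1 < τ) => ?_
    have hτ0 : 0 < τ := by linarith
    have h3 : ∀ Y : E2, ENNReal.ofReal ((g r - g (r * τ)) ^ 2 *
        ‖r • X - (r * τ) • Y‖ ^ (-(2:ℝ) - 2 * σ)) =
        ENNReal.ofReal ((g r - g (r * τ)) ^ 2 * r ^ (-(2:ℝ) - 2 * σ)) *
          ENNReal.ofReal (‖X - τ • Y‖ ^ (-(2:ℝ) - 2 * σ)) := by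
      intro Y
      rw [← ENNReal.ofReal_mul (by positivity), mul_smul, ← smul_sub, norm_smul,
        Real.norm_of_nonneg hr.le, Real.mul_rpow hr.le (norm_nonneg _), mul_assoc]
    simp only [k, h3]
    rw [lintegral_const_mul' _ _ (by simp), ← mul_assoc, ← mul_assoc,
      ← ENNReal.ofReal_mul hr.le, ← ENNReal.ofReal_mul (by positivity)]
    congr 2
    have h4 : r ^ (-(2 * σ)) = r * r * r ^ (-(2:ℝ) - 2 * σ) := by
      rw [← sq, ← Real.rpow_natCast, ← Real.rpow_add hr]
      congr 1; push_cast; ring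
    rw [h4]; ring
  beta_reduce
  rw [setLIntegral_congr_fun Metric.isClosed_sphere.measurableSet key, lintegral_lintegral_swap]
  · rw [← lintegral_const_mul' _ _ (by simp)]
    refine setLIntegral_congr_fun measurableSet_Ioi fun τ (hτ : 1 < τ) => ?_
    beta_reduce
    rw [lintegral_const_mul' _ _ (by simp), ← mul_assoc, ← ENNReal.ofReal_mul hr.le]
    congr 2
    have h4 : r ^ (1 - 2 * σ) = r * r ^ (-(2 * σ)) := by
      rw [sub_eq_add_neg, Real.rpow_add hr, Real.rpow_one]
    rw [h4]; ring
  · apply Measurable.aemeasurable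
    apply Measurable.mul
    · fun_prop
    · apply Measurable.lintegral_prod_right (f := fun (q : E2 × ℝ) (Y : E2) =>
        ENNReal.ofReal (‖q.1 - q.2 • Y‖ ^ (-(2:ℝ) - 2 * σ)))
      fun_prop
end
end

section
/- There exists a universal constant C such that for every σ ∈ (1/2,1) there is a function ζ ∈ C_c^∞((0,∞)), not identically zero, satisfying I[ζ,σ] ≤ C(1−σ) J[ζ,σ], where I[ζ,σ] := ∫_0^∞ dr r^{1−2σ} ∫_1^∞ dτ τ |ζ(r)−ζ(rτ)|² (∬_{S¹×S¹} |X̂ − τŶ|^{−2−2σ} dH¹(X̂) dH¹(Ŷ)) and J[ζ,σ] := ∫_0^∞ dr r^{1−2σ} |ζ(r)|². -/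
open MeasureTheory
open scoped ENNReal

noncomputable section

/-- The double integral over `S¹ × S¹` of the kernel `|X̂ − τŶ|^{−2−2σ}`. -/
def sphereKernelInt (σ τ : ℝ) : ℝ≥0∞ :=
  ∫⁻ X in Metric.sphere (0:E2) 1, ∫⁻ Y in Metric.sphere (0:E2) 1,
    ENNReal.ofReal (‖X - τ • Y‖ ^ (-(2:ℝ) - 2 * σ)) ∂μH[1] ∂μH[1]

/-- `I[ζ,σ]`: the polar form of the Gagliardo energy of the radial extension of `ζ`. -/
def Ifun (ζ : ℝ → ℝ) (σ : ℝ) : ℝ≥0∞ :=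
  ∫⁻ r in Set.Ioi (0:ℝ), ∫⁻ τ in Set.Ioi (1:ℝ),
    ENNReal.ofReal (r ^ (1 - 2 * σ) * τ * (ζ r - ζ (r * τ)) ^ 2) * sphereKernelInt σ τ

/-- `J[ζ,σ] = ∫_0^∞ r^{1−2σ} ζ(r)² dr`. -/
def Jfun (ζ : ℝ → ℝ) (σ : ℝ) : ℝ≥0∞ :=
  ∫⁻ r in Set.Ioi (0:ℝ), ENNReal.ofReal (r ^ (1 - 2 * σ) * ζ r ^ 2)

def gc (θ : ℝ) : E2 := !₂[Real.cos θ, Real.sin θ]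

lemma gc_sq (α θ τ : ℝ) : ‖gc α - τ • gc θ‖ ^ 2 = (τ - 1) ^ 2 + 2 * τ * (1 - Real.cos (θ - α)) := by
  rw [EuclideanSpace.norm_sq_eq]
  simp only [gc, Fin.sum_univ_two, PiLp.sub_apply, PiLp.smul_apply, smul_eq_mul, Real.norm_eq_abs, sq_abs, Matrix.cons_val_zero, Matrix.cons_val_one]
  rw [Real.cos_sub]
  linear_combination Real.sin_sq_add_cos_sq α + τ ^ 2 * Real.sin_sq_add_cos_sq θ

lemma gc_lip : LipschitzWith 1 gc := by
  apply LipschitzWith.of_dist_le_mul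
  intro a b
  have h := gc_sq a b 1
  rw [one_smul] at h
  rw [dist_eq_norm, Real.dist_eq]
  simp only [NNReal.coe_one, one_mul]
  apply abs_le_of_sq_le_sq' _ (abs_nonneg _) |>.2
  rw [h, sq_abs]
  nlinarith [Real.one_sub_sq_div_two_le_cos (x := b - a)]

lemma gc_surj (α : ℝ) (Y : E2) (hY : Y ∈ Metric.sphere (0:E2) 1) :
    ∃ θ ∈ Set.Icc (α - Real.pi) (α + Real.pi), gc θ = Y := by
  have h1 : Y 0 ^ 2 + Y 1 ^ 2 = 1 := by
    have : ‖Y‖ ^ 2 = 1 := by simp at hY; rw [hY]; norm_num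
    rw [EuclideanSpace.norm_sq_eq] at this
    simpa [Fin.sum_univ_two] using this
  obtain ⟨θ₀, hc, hs⟩ : ∃ t : ℝ, Real.cos t = Y 0 ∧ Real.sin t = Y 1 := by
    have hn : ‖(⟨Y 0, Y 1⟩ : ℂ)‖ = 1 := by
      rw [Complex.norm_def, Complex.normSq_mk, ← sq, ← sq, h1, Real.sqrt_one]
    have h0 : (⟨Y 0, Y 1⟩ : ℂ) ≠ 0 := by
      intro h; rw [h] at hn; simp at hn
    refine ⟨Complex.arg ⟨Y 0, Y 1⟩, ?_, ?_⟩
    · rw [Complex.cos_arg h0, hn]; simp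
    · rw [Complex.sin_arg, hn]; simp
  refine ⟨toIocMod Real.two_pi_pos (α - Real.pi) θ₀, ?_, ?_⟩
  · have := toIocMod_mem_Ioc Real.two_pi_pos (α - Real.pi) θ₀
    exact ⟨this.1.le, by linarith [this.2]⟩
  · have e : toIocMod Real.two_pi_pos (α - Real.pi) θ₀ = θ₀ - toIocDiv Real.two_pi_pos (α - Real.pi) θ₀ * (2 * Real.pi) := by
      rw [toIocMod, zsmul_eq_mul]
    ext i
    fin_cases i
    · change Real.cos _ = Y 0
      rw [e, Real.cos_sub_int_mul_two_pi, hc]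
    · change Real.sin _ = Y 1
      rw [e, Real.sin_sub_int_mul_two_pi, hs]

lemma sphere_lint (α : ℝ) (F : E2 → ℝ≥0∞) :
    ∫⁻ Y in Metric.sphere (0:E2) 1, F Y ∂μH[1] ≤
      ∫⁻ θ in Set.Icc (α - Real.pi) (α + Real.pi), F (gc θ) := by
  have hm : Measurable gc := gc_lip.continuous.measurable
  have : (μH[1] : Measure E2).restrict (Metric.sphere (0:E2) 1) ≤
      Measure.map gc (volume.restrict (Set.Icc (α - Real.pi) (α + Real.pi))) := by
    rw [Measure.le_iff]
    intro s hs
    rw [Measure.restrict_apply hs, Measure.map_apply hm hs, Measure.restrict_apply (hm hs)]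
    have hsub : s ∩ Metric.sphere (0:E2) 1 ⊆ gc '' (gc ⁻¹' s ∩ Set.Icc (α - Real.pi) (α + Real.pi)) := by
      rintro Y ⟨hY, hY2⟩
      obtain ⟨θ, h1, h2⟩ := gc_surj α Y hY2
      exact ⟨θ, ⟨by rw [Set.mem_preimage, h2]; exact hY, h1⟩, h2⟩
    refine (measure_mono hsub).trans ?_
    refine (gc_lip.hausdorffMeasure_image_le zero_le_one _).trans ?_
    rw [hausdorffMeasure_real]
    simp
  refine (lintegral_mono' this le_rfl).trans ?_
  exact lintegral_map_le _ _

lemma sphere_meas : (μH[1] : Measure E2) (Metric.sphere (0:E2) 1) ≤ ENNReal.ofReal (2 * Real.pi) := by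
  have := sphere_lint 0 (fun _ => 1)
  simp only [lintegral_one, Measure.restrict_apply_univ, Real.volume_Icc] at this
  refine this.trans (le_of_eq ?_)
  congr 1; ring

lemma inner_int (c d : ℝ) (hc : 0 < c) (hd : 0 < d) (A α : ℝ) (hA : 0 ≤ A) :
    ∫⁻ θ : ℝ, ENNReal.ofReal (A * (1 + (c / d * (θ - α)) ^ 2)⁻¹) = ENNReal.ofReal (A * (d / c * Real.pi)) := by
  rw [lintegral_sub_right_eq_self (fun θ => ENNReal.ofReal (A * (1 + (c / d * θ) ^ 2)⁻¹)) α]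
  have hcd : c / d ≠ 0 := by positivity
  rw [← ofReal_integral_eq_lintegral_ofReal]
  · rw [integral_const_mul, Measure.integral_comp_mul_left (fun x : ℝ => (1 + x ^ 2)⁻¹), integral_univ_inv_one_add_sq]
    rw [abs_of_pos (by positivity)]
    simp
  · exact (integrable_inv_one_add_sq.comp_mul_left' hcd).const_mul A
  · filter_upwards with x; simp only [Pi.zero_apply]; positivity

lemma kernel_near (σ τ : ℝ) (hσ : σ ∈ Set.Ioo (1/2 : ℝ) 1) (hτ : 1 < τ) :
    sphereKernelInt σ τ ≤ ENNReal.ofReal (Real.pi ^ 3 * (τ - 1) ^ (-1 - 2 * σ)) := by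
  have hd : 0 < τ - 1 := by linarith
  have hpi := Real.pi_pos
  have hX : ∀ X ∈ Metric.sphere (0:E2) 1, ∫⁻ Y in Metric.sphere (0:E2) 1,
    ENNReal.ofReal (‖X - τ • Y‖ ^ (-(2:ℝ) - 2 * σ)) ∂μH[1] ≤ ENNReal.ofReal ((τ - 1) ^ (-2 - 2 * σ) * ((τ - 1) / (2 / Real.pi) * Real.pi)) := by
    intro X hX
    obtain ⟨α, -, rfl⟩ := gc_surj 0 X hX
    refine (sphere_lint α _).trans ?_
    rw [← inner_int (2 / Real.pi) (τ - 1) (by positivity) hd _ α (by positivity)]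
    refine le_trans ?_ (setLIntegral_le_lintegral (Set.Icc (α - Real.pi) (α + Real.pi)) _)
    apply setLIntegral_mono' measurableSet_Icc
    intro θ hθ
    apply ENNReal.ofReal_le_ofReal
    have hab : |θ - α| ≤ Real.pi := by rw [abs_le]; constructor <;> linarith [hθ.1, hθ.2]
    have hcos := Real.cos_le_one_sub_mul_cos_sq hab
    set q := 1 + (2 / Real.pi / (τ - 1) * (θ - α)) ^ 2 with hq
    have hq1 : 1 ≤ q := by rw [hq]; nlinarith [sq_nonneg (2 / Real.pi / (τ - 1) * (θ - α))]
    have hlow : ((τ - 1) * q ^ (1/2 : ℝ)) ^ 2 ≤ ‖gc α - τ • gc θ‖ ^ 2 := by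
      rw [gc_sq, mul_pow, ← Real.sqrt_eq_rpow, Real.sq_sqrt (by linarith), hq]
      have e : (τ - 1) ^ 2 * (1 + (2 / Real.pi / (τ - 1) * (θ - α)) ^ 2) = (τ - 1) ^ 2 + 2 * (2 / Real.pi ^ 2 * (θ - α) ^ 2) := by
        field_simp
      rw [e]
      have h0 : 0 ≤ 2 / Real.pi ^ 2 * (θ - α) ^ 2 := by positivity
      nlinarith
    have hlow2 := (abs_le_of_sq_le_sq' hlow (norm_nonneg _)).2
    calc ‖gc α - τ • gc θ‖ ^ (-(2:ℝ) - 2 * σ) ≤ ((τ - 1) * q ^ (1/2 : ℝ)) ^ (-(2:ℝ) - 2 * σ) := by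
          apply Real.rpow_le_rpow_of_nonpos (by positivity) hlow2; linarith [hσ.1]
      _ = (τ - 1) ^ (-(2:ℝ) - 2 * σ) * q ^ (1/2 * (-(2:ℝ) - 2 * σ)) := by
          rw [Real.mul_rpow hd.le (by positivity), ← Real.rpow_mul (by linarith)]
      _ ≤ _ := by
          gcongr
          rw [← Real.rpow_neg_one]
          apply Real.rpow_le_rpow_of_exponent_le hq1
          linarith [hσ.1]
  unfold sphereKernelInt
  refine (setLIntegral_mono' Metric.isClosed_sphere.measurableSet hX).trans ?_
  rw [setLIntegral_const]
  refine (mul_le_mul_right sphere_meas _).trans (le_of_eq ?_)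
  rw [← ENNReal.ofReal_mul (by positivity)]
  congr 1
  rw [show -1 - 2 * σ = (-2 - 2 * σ) + 1 by ring, Real.rpow_add hd, Real.rpow_one]
  field_simp

lemma kernel_far (σ τ : ℝ) (hσ : σ ∈ Set.Ioo (1/2 : ℝ) 1) (hτ : 2 < τ) :
    sphereKernelInt σ τ ≤ ENNReal.ofReal (32 * Real.pi ^ 2 * τ ^ (-3 : ℝ)) := by
  have hpi := Real.pi_pos
  have h0 : ∀ X ∈ Metric.sphere (0:E2) 1, ∀ Y ∈ Metric.sphere (0:E2) 1,
    ENNReal.ofReal (‖X - τ • Y‖ ^ (-(2:ℝ) - 2 * σ)) ≤ ENNReal.ofReal (8 * τ ^ (-3 : ℝ)) := by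
    intro X hX Y hY
    apply ENNReal.ofReal_le_ofReal
    have h1 : τ / 2 ≤ ‖X - τ • Y‖ := by
      have := norm_sub_norm_le (τ • Y) X
      rw [norm_sub_rev, norm_smul, Real.norm_eq_abs, abs_of_pos (by linarith)] at this
      simp at hX hY
      rw [hX, hY] at this
      linarith
    calc ‖X - τ • Y‖ ^ (-(2:ℝ) - 2 * σ) ≤ (τ / 2) ^ (-(2:ℝ) - 2 * σ) :=
          Real.rpow_le_rpow_of_nonpos (by linarith) h1 (by linarith [hσ.1])
      _ ≤ (τ / 2) ^ (-3 : ℝ) := Real.rpow_le_rpow_of_exponent_le (by linarith) (by linarith [hσ.1])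
      _ = _ := by
          rw [Real.div_rpow (by linarith) (by norm_num), show (2:ℝ) ^ (-3:ℝ) = 1/8 by
            rw [Real.rpow_neg (by norm_num)]; norm_num]
          ring
  unfold sphereKernelInt
  have hm := (Metric.isClosed_sphere (x := (0:E2)) (ε := 1)).measurableSet
  refine (setLIntegral_mono' hm fun X hX => setLIntegral_mono' hm (h0 X hX)).trans ?_
  rw [setLIntegral_const, setLIntegral_const]
  refine (mul_le_mul' (mul_le_mul_right sphere_meas _) sphere_meas).trans (le_of_eq ?_)
  rw [← ENNReal.ofReal_mul (by positivity), ← ENNReal.ofReal_mul (by positivity)]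
  congr 1
  ring

def zet (φ : ℝ → ℝ) (ε r : ℝ) : ℝ :=
  if 0 < r then Real.exp (-(ε * Real.log r)) * φ (ε * Real.log r) else 0

lemma zet_exp (φ : ℝ → ℝ) (ε u : ℝ) (hε : 0 < ε) :
    zet φ ε (Real.exp (u / ε)) = Real.exp (-u) * φ u := by
  rw [zet, if_pos (Real.exp_pos _), Real.log_exp, mul_div_cancel₀ _ hε.ne']

lemma zet_zero (φ : ℝ → ℝ) (hφ : ∀ x, 2 ≤ |x| → φ x = 0) (ε r : ℝ) (hε : 0 < ε)
    (hr : r ∉ Set.Icc (Real.exp (-2 / ε)) (Real.exp (2 / ε))) : zet φ ε r = 0 := by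
  unfold zet
  split_ifs with h
  · rw [hφ, mul_zero]
    by_contra hc
    push Not at hc
    rw [abs_lt] at hc
    apply hr
    constructor
    · rw [← Real.le_log_iff_exp_le h, div_le_iff₀ hε]; linarith
    · rw [← Real.log_le_iff_le_exp h, le_div_iff₀ hε]; linarith
  · rfl

lemma zet_contDiff (φ : ℝ → ℝ) (hs : ContDiff ℝ (⊤ : ℕ∞) φ) (hφ : ∀ x, 2 ≤ |x| → φ x = 0)
    (ε : ℝ) (hε : 0 < ε) : ContDiff ℝ (⊤ : ℕ∞) (zet φ ε) := by
  rw [contDiff_iff_contDiffAt]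
  intro r
  rcases lt_or_ge 0 r with h | h
  · have : zet φ ε =ᶠ[nhds r] fun r => Real.exp (-(ε * Real.log r)) * φ (ε * Real.log r) := by
      filter_upwards [lt_mem_nhds h] with x hx
      rw [zet, if_pos hx]
    refine ContDiffAt.congr_of_eventuallyEq ?_ this
    have hl : ContDiffAt ℝ (⊤ : ℕ∞) (fun r => ε * Real.log r) r :=
      contDiffAt_const.mul (Real.contDiffAt_log.2 h.ne')
    exact (hl.neg.exp).mul (hs.contDiffAt.comp r hl)
  · have : zet φ ε =ᶠ[nhds r] fun _ => 0 := by
      filter_upwards [gt_mem_nhds (lt_of_le_of_lt h (Real.exp_pos (-2 / ε)))] with x hx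
      exact zet_zero φ hφ ε x hε fun hc => absurd hc.1 (not_le.2 hx)
    exact contDiffAt_const.congr_of_eventuallyEq this

lemma zet_supp (φ : ℝ → ℝ) (hφ : ∀ x, 2 ≤ |x| → φ x = 0)
    (ε : ℝ) (hε : 0 < ε) : HasCompactSupport (zet φ ε) ∧ tsupport (zet φ ε) ⊆ Set.Ioi (0:ℝ) := by
  refine ⟨HasCompactSupport.intro isCompact_Icc fun x hx => zet_zero φ hφ ε x hε hx, ?_⟩
  have : tsupport (zet φ ε) ⊆ Set.Icc (Real.exp (-2 / ε)) (Real.exp (2 / ε)) := by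
    apply closure_minimal _ isClosed_Icc
    intro x hx
    by_contra hc
    exact hx (zet_zero φ hφ ε x hε hc)
  exact this.trans fun x hx => lt_of_lt_of_le (Real.exp_pos _) hx.1

lemma subst_exp (ε : ℝ) (hε : 0 < ε) (G : ℝ → ℝ≥0∞) :
    ∫⁻ r in Set.Ioi (0:ℝ), G r =
      ∫⁻ u : ℝ, ENNReal.ofReal (Real.exp (u / ε) / ε) * G (Real.exp (u / ε)) := by
  have himg : (fun u : ℝ => Real.exp (u / ε)) '' Set.univ = Set.Ioi 0 := by
    rw [Set.image_univ]
    ext x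
    constructor
    · rintro ⟨u, rfl⟩; exact Real.exp_pos _
    · intro hx
      refine ⟨ε * Real.log x, ?_⟩
      simp only
      rw [mul_div_cancel_left₀ _ hε.ne', Real.exp_log hx]
  have := lintegral_image_eq_lintegral_abs_deriv_mul (s := Set.univ)
    (f := fun u : ℝ => Real.exp (u / ε)) (f' := fun u => Real.exp (u / ε) * (1 / ε)) MeasurableSet.univ
    (fun x _ => (((hasDerivAt_id x).div_const ε).exp).hasDerivWithinAt)
    (fun x _ y _ h => by
      have := Real.exp_injective h
      field_simp at this
      exact this) G
  rw [himg, Measure.restrict_univ] at this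
  rw [this]
  apply lintegral_congr
  intro u
  rw [abs_of_pos (by positivity), mul_one_div]

lemma J_eq (φ : ℝ → ℝ) (σ : ℝ) (hσ : σ < 1) :
    Jfun (zet φ (1 - σ)) σ = ∫⁻ u : ℝ, ENNReal.ofReal (φ u ^ 2 / (1 - σ)) := by
  have hε : 0 < 1 - σ := by linarith
  rw [Jfun, subst_exp (1 - σ) hε]
  apply lintegral_congr
  intro u
  rw [← ENNReal.ofReal_mul (by positivity), zet_exp _ _ _ hε, ← Real.exp_mul]
  congr 1
  have : Real.exp (u / (1 - σ)) * Real.exp (u / (1 - σ) * (1 - 2 * σ)) * Real.exp (-u) ^ 2 = 1 := by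
    rw [sq, ← Real.exp_add, ← Real.exp_add, ← Real.exp_add, Real.exp_eq_one_iff]
    field_simp
    ring
  linear_combination φ u ^ 2 / (1 - σ) * this

lemma A_eq (φ : ℝ → ℝ) (σ h : ℝ) (hσ : σ < 1) :
    ∫⁻ r in Set.Ioi (0:ℝ), ENNReal.ofReal (r ^ (1 - 2 * σ) *
      (zet φ (1 - σ) r - zet φ (1 - σ) (r * Real.exp (h / (1 - σ)))) ^ 2)
      = ∫⁻ u : ℝ, ENNReal.ofReal ((φ u - Real.exp (-h) * φ (u + h)) ^ 2 / (1 - σ)) := by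
  have hε : 0 < 1 - σ := by linarith
  rw [subst_exp (1 - σ) hε]
  apply lintegral_congr
  intro u
  rw [← ENNReal.ofReal_mul (by positivity), ← Real.exp_add, ← add_div, zet_exp _ _ _ hε, zet_exp _ _ _ hε, ← Real.exp_mul]
  congr 1
  have : Real.exp (u / (1 - σ)) * Real.exp (u / (1 - σ) * (1 - 2 * σ)) * Real.exp (-u) ^ 2 = 1 := by
    rw [sq, ← Real.exp_add, ← Real.exp_add, ← Real.exp_add, Real.exp_eq_one_iff]
    field_simp
    ring
  rw [neg_add, Real.exp_add]
  linear_combination (φ u - Real.exp (-h) * φ (u + h)) ^ 2 / (1 - σ) * this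

lemma A_le (φ : ℝ → ℝ) (L : ℝ) (hL : ∀ x y, |φ x - φ y| ≤ L * |x - y|) (hφ : ∀ x, 2 ≤ |x| → φ x = 0)
    (hb : ∀ x, |φ x| ≤ 1) (σ τ : ℝ) (hσ : σ < 1) (hτ : 1 < τ) :
    ∫⁻ r in Set.Ioi (0:ℝ), ENNReal.ofReal (r ^ (1 - 2 * σ) *
      (zet φ (1 - σ) r - zet φ (1 - σ) (r * τ)) ^ 2) ≤
      ENNReal.ofReal (8 * (L + 1) ^ 2 * (1 - σ) * Real.log τ ^ 2) := by
  have hε : 0 < 1 - σ := by linarith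
  have hlog := Real.log_pos hτ
  set h := (1 - σ) * Real.log τ with hh
  have hh0 : 0 < h := by positivity
  have e : τ = Real.exp (h / (1 - σ)) := by
    rw [hh, mul_div_cancel_left₀ _ hε.ne', Real.exp_log (by linarith)]
  have hA := A_eq φ σ h hσ
  rw [← e] at hA
  rw [hA]
  have hpt : ∀ u, (φ u - Real.exp (-h) * φ (u + h)) ^ 2 / (1 - σ) ≤ ((L + 1) * h) ^ 2 / (1 - σ) := by
    intro u
    gcongr ?_ / _
    apply sq_le_sq'
    all_goals
      have h1 := abs_le.1 (hL u (u + h))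
      have h2 := abs_le.1 (hb (u + h))
      have h3 := Real.add_one_le_exp (-h)
      have h4 : Real.exp (-h) ≤ 1 := Real.exp_le_one_iff.2 (by linarith)
      rw [show u - (u + h) = -h by ring, abs_neg, abs_of_pos hh0] at h1
      nlinarith
  set S := Set.Icc (-2 : ℝ) 2 ∪ Set.Icc (-2 - h) (2 - h)
  have hS : MeasurableSet S := measurableSet_Icc.union measurableSet_Icc
  have hle : ∀ u, ENNReal.ofReal ((φ u - Real.exp (-h) * φ (u + h)) ^ 2 / (1 - σ)) ≤
      S.indicator (fun _ => ENNReal.ofReal (((L + 1) * h) ^ 2 / (1 - σ))) u := by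
    intro u
    by_cases hu : u ∈ S
    · rw [Set.indicator_of_mem hu]; exact ENNReal.ofReal_le_ofReal (hpt u)
    · rw [Set.indicator_of_notMem hu]
      have h1 : φ u = 0 := by
        apply hφ; by_contra hc; push Not at hc; rw [abs_lt] at hc
        exact hu (Or.inl ⟨hc.1.le, hc.2.le⟩)
      have h2 : φ (u + h) = 0 := by
        apply hφ; by_contra hc; push Not at hc; rw [abs_lt] at hc
        exact hu (Or.inr ⟨by linarith, by linarith⟩)
      simp [h1, h2]
  refine (lintegral_mono hle).trans ?_
  rw [lintegral_indicator hS, setLIntegral_const]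
  have hv : volume S ≤ ENNReal.ofReal 8 := by
    refine (measure_union_le _ _).trans ?_
    rw [Real.volume_Icc, Real.volume_Icc, ← ENNReal.ofReal_add (by norm_num) (by linarith)]
    apply ENNReal.ofReal_le_ofReal; linarith
  refine (mul_le_mul_right hv _).trans (le_of_eq ?_)
  rw [← ENNReal.ofReal_mul (by positivity)]
  congr 1
  rw [hh]; field_simp

lemma J_ge (φ : ℝ → ℝ) (h1 : ∀ x, |x| ≤ 1 → φ x = 1) (σ : ℝ) (hσ : σ < 1) :
    ENNReal.ofReal (1 / (1 - σ)) ≤ Jfun (zet φ (1 - σ)) σ := by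
  have hε : 0 < 1 - σ := by linarith
  rw [J_eq φ σ hσ]
  calc ENNReal.ofReal (1 / (1 - σ)) = ∫⁻ u in Set.Icc (0:ℝ) 1, ENNReal.ofReal (1 / (1 - σ)) := by
        rw [setLIntegral_const, Real.volume_Icc]; simp
    _ ≤ ∫⁻ u in Set.Icc (0:ℝ) 1, ENNReal.ofReal (φ u ^ 2 / (1 - σ)) := by
        apply setLIntegral_mono' measurableSet_Icc
        intro u hu
        rw [h1 u (by rw [abs_le]; constructor <;> linarith [hu.1, hu.2])]
        simp
    _ ≤ _ := setLIntegral_le_lintegral _ _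

def kb (σ τ : ℝ) : ℝ≥0∞ :=
  if τ ≤ 2 then ENNReal.ofReal (Real.pi ^ 3 * (τ - 1) ^ (-1 - 2 * σ))
  else ENNReal.ofReal (32 * Real.pi ^ 2 * τ ^ (-3 : ℝ))

lemma kb_meas (σ : ℝ) : Measurable (kb σ) := by
  unfold kb
  apply Measurable.ite measurableSet_Iic <;> fun_prop

lemma kernel_le (σ τ : ℝ) (hσ : σ ∈ Set.Ioo (1/2 : ℝ) 1) (hτ : 1 < τ) :
    sphereKernelInt σ τ ≤ kb σ τ := by
  unfold kb
  split_ifs with h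
  · exact kernel_near σ τ hσ hτ
  · exact kernel_far σ τ hσ (not_le.1 h)

lemma near_int (σ : ℝ) (hσ : σ < 1) :
    ∫⁻ τ in Set.Ioc (1:ℝ) 2, ENNReal.ofReal ((τ - 1) ^ (1 - 2 * σ)) = ENNReal.ofReal (1 / (2 * (1 - σ))) := by
  have hI : IntervalIntegrable (fun τ : ℝ => (τ - 1) ^ (1 - 2 * σ)) volume 1 2 := by
    have := (intervalIntegral.intervalIntegrable_rpow' (a := 0) (b := 1) (r := 1 - 2 * σ) (by linarith)).comp_sub_right 1
    norm_num at this
    exact this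
  rw [← ofReal_integral_eq_lintegral_ofReal]
  · rw [← intervalIntegral.integral_of_le (by norm_num), intervalIntegral.integral_comp_sub_right (fun x => x ^ (1 - 2 * σ)),
      integral_rpow (Or.inl (by linarith))]
    norm_num
    rw [Real.zero_rpow (by linarith)]
    have h1 : (1 - σ) ≠ 0 := by linarith
    have h2 : (1 - 2 * σ + 1) = 2 * (1 - σ) := by ring
    rw [h2]
    congr 1
    field_simp
    try norm_num
  · exact (intervalIntegrable_iff_integrableOn_Ioc_of_le (by norm_num)).1 hI
  · filter_upwards [ae_restrict_mem measurableSet_Ioc] with τ hτ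
    exact Real.rpow_nonneg (by linarith [hτ.1]) _

lemma far_int :
    ∫⁻ τ in Set.Ioi (2:ℝ), ENNReal.ofReal (τ ^ (-(3/2) : ℝ)) ≤ ENNReal.ofReal 2 := by
  rw [← ofReal_integral_eq_lintegral_ofReal]
  · rw [integral_Ioi_rpow_of_lt (by norm_num) (by norm_num)]
    apply ENNReal.ofReal_le_ofReal
    have : (2:ℝ) ^ (-(3/2) + 1 : ℝ) ≤ 1 := Real.rpow_le_one_of_one_le_of_nonpos (by norm_num) (by norm_num)
    norm_num at this ⊢
    linarith
  · exact integrableOn_Ioi_rpow_of_lt (by norm_num) (by norm_num)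
  · filter_upwards [ae_restrict_mem measurableSet_Ioi] with τ hτ
    exact Real.rpow_nonneg (by linarith [Set.mem_Ioi.1 hτ]) _

lemma tau_int (σ D : ℝ) (hσ : σ ∈ Set.Ioo (1/2 : ℝ) 1) (hD : 0 ≤ D) :
    ∫⁻ τ in Set.Ioi (1:ℝ), ENNReal.ofReal τ * kb σ τ * ENNReal.ofReal (D * (1 - σ) * Real.log τ ^ 2)
      ≤ ENNReal.ofReal (D * Real.pi ^ 3 + 1024 * D * Real.pi ^ 2) := by
  have hε : 0 < 1 - σ := by linarith [hσ.2]
  have hpi := Real.pi_pos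
  rw [← Set.Ioc_union_Ioi_eq_Ioi (show (1:ℝ) ≤ 2 by norm_num)]
  refine (lintegral_union_le _ _ _).trans ?_
  rw [ENNReal.ofReal_add (by positivity) (by positivity)]
  gcongr
  · calc _ ≤ ∫⁻ τ in Set.Ioc (1:ℝ) 2, ENNReal.ofReal (2 * D * (1 - σ) * Real.pi ^ 3) * ENNReal.ofReal ((τ - 1) ^ (1 - 2 * σ)) := by
          apply setLIntegral_mono' measurableSet_Ioc
          intro τ hτ
          have hd : 0 < τ - 1 := by linarith [hτ.1]
          rw [kb, if_pos hτ.2, ← ENNReal.ofReal_mul (by linarith), ← ENNReal.ofReal_mul (by have := hτ.1; positivity), ← ENNReal.ofReal_mul (by positivity)]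
          apply ENNReal.ofReal_le_ofReal
          have hl : Real.log τ ^ 2 ≤ (τ - 1) ^ 2 := by
            have := Real.log_le_sub_one_of_pos (show 0 < τ by linarith)
            have := Real.log_pos hτ.1
            gcongr
          rw [show 1 - 2 * σ = (-1 - 2 * σ) + 2 by ring, Real.rpow_add hd, Real.rpow_two]
          have h2 := hτ.2
          calc τ * (Real.pi ^ 3 * (τ - 1) ^ (-1 - 2 * σ)) * (D * (1 - σ) * Real.log τ ^ 2)
              ≤ 2 * (Real.pi ^ 3 * (τ - 1) ^ (-1 - 2 * σ)) * (D * (1 - σ) * (τ - 1) ^ 2) := by gcongr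
            _ = _ := by ring
      _ = _ := by
          rw [lintegral_const_mul _ (by fun_prop), near_int σ hσ.2, ← ENNReal.ofReal_mul (by positivity)]
          congr 1
          field_simp
  · calc _ ≤ ∫⁻ τ in Set.Ioi (2:ℝ), ENNReal.ofReal (512 * D * Real.pi ^ 2) * ENNReal.ofReal (τ ^ (-(3/2) : ℝ)) := by
          apply setLIntegral_mono' measurableSet_Ioi
          intro τ hτ
          have hτ : 2 < τ := hτ
          have h0 : 0 < τ := by linarith
          rw [kb, if_neg (not_le.2 hτ), ← ENNReal.ofReal_mul (by linarith), ← ENNReal.ofReal_mul (by positivity), ← ENNReal.ofReal_mul (by positivity)]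
          apply ENNReal.ofReal_le_ofReal
          have hl : Real.log τ ^ 2 ≤ 16 * τ ^ (1/2 : ℝ) := by
            have h1 := Real.log_le_rpow_div h0.le (show (0:ℝ) < 1/4 by norm_num)
            have h2 := Real.log_pos (show 1 < τ by linarith)
            calc Real.log τ ^ 2 ≤ (τ ^ (1/4 : ℝ) / (1/4)) ^ 2 := by gcongr
              _ = 16 * (τ ^ (1/4 : ℝ) * τ ^ (1/4 : ℝ)) := by ring
              _ = _ := by rw [← Real.rpow_add h0]; norm_num
          have e : τ ^ (-(3/2) : ℝ) = τ * τ ^ (-3 : ℝ) * τ ^ (1/2 : ℝ) := by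
            rw [← Real.rpow_one_add' h0.le (by norm_num), ← Real.rpow_add h0]; norm_num
          rw [e]
          have h1s : 1 - σ ≤ 1 := by linarith [hσ.1]
          calc τ * (32 * Real.pi ^ 2 * τ ^ (-3 : ℝ)) * (D * (1 - σ) * Real.log τ ^ 2)
              ≤ τ * (32 * Real.pi ^ 2 * τ ^ (-3 : ℝ)) * (D * 1 * (16 * τ ^ (1/2 : ℝ))) := by gcongr
            _ = _ := by ring
      _ ≤ _ := by
          rw [lintegral_const_mul _ (by fun_prop)]
          refine (mul_le_mul_right far_int _).trans (le_of_eq ?_)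
          rw [← ENNReal.ofReal_mul (by positivity)]
          congr 1
          ring

lemma I_le (φ : ℝ → ℝ) (hs : ContDiff ℝ (⊤ : ℕ∞) φ) (L : ℝ) (hL : ∀ x y, |φ x - φ y| ≤ L * |x - y|) (hφ : ∀ x, 2 ≤ |x| → φ x = 0)
    (hb : ∀ x, |φ x| ≤ 1) (σ : ℝ) (hσ : σ ∈ Set.Ioo (1/2 : ℝ) 1) :
    Ifun (zet φ (1 - σ)) σ ≤
      ENNReal.ofReal (8 * (L + 1) ^ 2 * Real.pi ^ 3 + 1024 * (8 * (L + 1) ^ 2) * Real.pi ^ 2) := by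
  have hε : 0 < 1 - σ := by linarith [hσ.2]
  have hz : Measurable (zet φ (1 - σ)) := (zet_contDiff φ hs hφ _ hε).continuous.measurable
  have hk := kb_meas σ
  calc Ifun (zet φ (1 - σ)) σ ≤ ∫⁻ r in Set.Ioi (0:ℝ), ∫⁻ τ in Set.Ioi (1:ℝ),
        ENNReal.ofReal τ * kb σ τ * ENNReal.ofReal (r ^ (1 - 2 * σ) * (zet φ (1 - σ) r - zet φ (1 - σ) (r * τ)) ^ 2) := by
        unfold Ifun
        apply setLIntegral_mono' measurableSet_Ioi
        intro r hr
        apply setLIntegral_mono' measurableSet_Ioi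
        intro τ hτ
        have hτ : 1 < τ := hτ
        have hr : 0 < r := hr
        refine (mul_le_mul_right (kernel_le σ τ hσ hτ) _).trans (le_of_eq ?_)
        rw [show r ^ (1 - 2 * σ) * τ * (zet φ (1 - σ) r - zet φ (1 - σ) (r * τ)) ^ 2 =
          τ * (r ^ (1 - 2 * σ) * (zet φ (1 - σ) r - zet φ (1 - σ) (r * τ)) ^ 2) by ring, ENNReal.ofReal_mul (by linarith)]
        ring
    _ = ∫⁻ τ in Set.Ioi (1:ℝ), ∫⁻ r in Set.Ioi (0:ℝ),
        ENNReal.ofReal τ * kb σ τ * ENNReal.ofReal (r ^ (1 - 2 * σ) * (zet φ (1 - σ) r - zet φ (1 - σ) (r * τ)) ^ 2) := by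
        apply lintegral_lintegral_swap
        apply Measurable.aemeasurable
        unfold Function.uncurry
        fun_prop
    _ ≤ ∫⁻ τ in Set.Ioi (1:ℝ), ENNReal.ofReal τ * kb σ τ * ENNReal.ofReal (8 * (L + 1) ^ 2 * (1 - σ) * Real.log τ ^ 2) := by
        apply setLIntegral_mono' measurableSet_Ioi
        intro τ hτ
        rw [lintegral_const_mul _ (by fun_prop)]
        exact mul_le_mul_right (A_le φ L hL hφ hb σ τ hσ.2 hτ) _
    _ ≤ _ := tau_int σ _ hσ (by positivity)

/-- there is a universal constant `C` such that for every `σ ∈ (1/2,1)`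
some nontrivial `ζ ∈ C_c^∞((0,∞))` satisfies `I[ζ,σ] ≤ C (1−σ) J[ζ,σ]`. -/
theorem hardy_polar_almost_saturation :
    ∃ C : ℝ, 0 < C ∧ ∀ σ ∈ Set.Ioo (1/2 : ℝ) 1,
      ∃ ζ : ℝ → ℝ, ContDiff ℝ (⊤ : ℕ∞) ζ ∧ HasCompactSupport ζ ∧
        tsupport ζ ⊆ Set.Ioi (0:ℝ) ∧ ζ ≠ 0 ∧
        Ifun ζ σ ≤ ENNReal.ofReal (C * (1 - σ)) * Jfun ζ σ := by
  let φ : ContDiffBump (0:ℝ) := ⟨1, 2, one_pos, one_lt_two⟩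
  have hs : ContDiff ℝ (⊤ : ℕ∞) φ := φ.contDiff
  obtain ⟨L, hL⟩ := hs.lipschitzWith_of_hasCompactSupport φ.hasCompactSupport (by simp)
  have hL' : ∀ x y, |φ x - φ y| ≤ L * |x - y| := fun x y => by
    simpa [Real.dist_eq] using hL.dist_le_mul x y
  have hφ : ∀ x, 2 ≤ |x| → φ x = 0 := fun x hx => φ.zero_of_le_dist (by simpa [Real.dist_eq] using hx)
  have hb : ∀ x, |φ x| ≤ 1 := fun x => by rw [abs_of_nonneg φ.nonneg]; exact φ.le_one
  have h1 : ∀ x, |x| ≤ 1 → φ x = 1 := fun x hx =>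
    φ.one_of_mem_closedBall (by simpa [Real.dist_eq] using hx)
  have hpi := Real.pi_pos
  refine ⟨8 * ((L:ℝ) + 1) ^ 2 * Real.pi ^ 3 + 1024 * (8 * ((L:ℝ) + 1) ^ 2) * Real.pi ^ 2, by positivity, ?_⟩
  intro σ hσ
  have hε : 0 < 1 - σ := by linarith [hσ.2]
  refine ⟨zet φ (1 - σ), zet_contDiff φ hs hφ _ hε, (zet_supp φ hφ _ hε).1, (zet_supp φ hφ _ hε).2, ?_, ?_⟩
  · intro h
    have := zet_exp φ (1 - σ) 0 hε
    rw [h, h1 0 (by simp)] at this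
    simp at this
  · refine (I_le φ hs L hL' hφ hb σ hσ).trans ?_
    refine le_trans (le_of_eq ?_) (mul_le_mul_right (J_ge φ h1 σ hσ.2) _)
    rw [← ENNReal.ofReal_mul (by positivity)]
    congr 1
    field_simp
end
end
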